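/- arXiv:math/0703682 — 3 statements merged into one kernel-verified Lean document; each statement's English description precedes it below -/
import Mathlib

section
/- Let δ ≥ 3 be an integer and λ : A_δ → ℝ smooth. Call a tropical line L with L ⊆ V(λ) isolated if for every pair of distinct points P, Q ∈ L, the set of tropical lines L' with L' ⊆ V(λ) and P, Q ∈ L' is finite. Then the set of isolated tropical lines contained in V(λ) is finite. -/
open scoped BigOperators

noncomputable section

/-- Points of `ℝ³`. -/
abbrev V3 : Type := Fin 3 → ℝ

/-- The canonical embedding of a lattice point of `ℤ³` into `ℝ³`. -/
def zToR (a : Fin 3 → ℤ) : V3 := fun i => (a i : ℝ)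

/-- The pairing `⟨a, x⟩ = ∑ aᵢ xᵢ` of a lattice point `a ∈ ℤ³` with `x ∈ ℝ³`. -/
def dotZR (a : Fin 3 → ℤ) (x : V3) : ℝ := ∑ i, (a i : ℝ) * x i

/-- The lattice points of `Γ_δ`:
`A_δ = {a ∈ ℤ³ : a₁,a₂,a₃ ≥ 0, a₁+a₂+a₃ ≤ δ}`. -/
def Adelta (δ : ℕ) : Set (Fin 3 → ℤ) :=
  {a | (∀ i, 0 ≤ a i) ∧ a 0 + a 1 + a 2 ≤ (δ : ℤ)}

/-- The argmax set `S_λ(x) = {a ∈ A_δ : λ(a) + ⟨a,x⟩ = max_{b ∈ A_δ} (λ(b) + ⟨b,x⟩)}`. -/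
def Sarg (δ : ℕ) (lam : (Fin 3 → ℤ) → ℝ) (x : V3) : Set (Fin 3 → ℤ) :=
  {a | a ∈ Adelta δ ∧ ∀ b ∈ Adelta δ, lam b + dotZR b x ≤ lam a + dotZR a x}

/-- The tropical surface `V(λ) = {x ∈ ℝ³ : S_λ(x) has at least 2 elements}`. -/
def Vtrop (δ : ℕ) (lam : (Fin 3 → ℤ) → ℝ) : Set V3 :=
  {x | ∃ a ∈ Sarg δ lam x, ∃ b ∈ Sarg δ lam x, a ≠ b}

/-- The determinant of the `3×3` integer matrix with rows `u, v, w`. -/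
def detZ (u v w : Fin 3 → ℤ) : ℤ := Matrix.det (Matrix.of ![u, v, w])

/-- `λ` is smooth (tropically): for every `x ∈ ℝ³` the set `S_λ(x)` is affinely independent in `ℝ³`,
and whenever `S_λ(x)` has exactly 4 elements `a₀,a₁,a₂,a₃`, the tetrahedron they span is
unimodular: `|det(a₁−a₀, a₂−a₀, a₃−a₀)| = 1`. -/
def TropSmooth (δ : ℕ) (lam : (Fin 3 → ℤ) → ℝ) : Prop :=
  ∀ x : V3,
    AffineIndependent ℝ (fun a : Sarg δ lam x => zToR a.1) ∧
    ∀ a₀ a₁ a₂ a₃ : Fin 3 → ℤ,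
      Sarg δ lam x = {a₀, a₁, a₂, a₃} → (Sarg δ lam x).ncard = 4 →
      |detZ (a₁ - a₀) (a₂ - a₀) (a₃ - a₀)| = 1

/-- The four directions `ω₁ = −e₁`, `ω₂ = −e₂`, `ω₃ = −e₃`, `ω₄ = e₁+e₂+e₃`. -/
def ωdir : Fin 4 → V3 := ![![-1, 0, 0], ![0, -1, 0], ![0, 0, -1], ![1, 1, 1]]

/-- The closed ray from `p` in direction `d`. -/
def ray (p d : V3) : Set V3 := {x | ∃ t : ℝ, 0 ≤ t ∧ x = p + t • d}

/-- The tropical line with vertices `v, w`, rays in directions `ω_i, ω_j` at `v` and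
`ω_k, ω_l` at `w`. -/
def TLine (v w : V3) (i j k l : Fin 4) : Set V3 :=
  ray v (ωdir i) ∪ ray v (ωdir j) ∪ segment ℝ v w ∪ ray w (ωdir k) ∪ ray w (ωdir l)

/-- The data `(v, w, i, j, k, l)` describes a genuine tropical line: `{i,j,k,l} = {1,2,3,4}`
and `w = v + t·(ω_k + ω_l)` for some `t ≥ 0`. -/
def IsTLineData (v w : V3) (i j k l : Fin 4) : Prop :=
  ({i, j, k, l} : Finset (Fin 4)) = Finset.univ ∧
  ∃ t : ℝ, 0 ≤ t ∧ w = v + t • (ωdir k + ωdir l)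

/-- A subset `L ⊆ ℝ³` is a tropical line. -/
def IsTropicalLine (L : Set V3) : Prop :=
  ∃ v w i j k l, IsTLineData v w i j k l ∧ L = TLine v w i j k l

/-! ### Basic facts about `Sarg` -/

lemma dot_line (a : Fin 3 → ℤ) (v d : V3) (s : ℝ) :
    dotZR a (v + s • d) = dotZR a v + s * dotZR a d := by
  simp [dotZR, Fin.sum_univ_three]; ring

lemma dot_comb (a : Fin 3 → ℤ) (x y : V3) (p q : ℝ) :
    dotZR a (p • x + q • y) = p * dotZR a x + q * dotZR a y := by
  simp [dotZR, Fin.sum_univ_three]; ring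

lemma dot_sub_right (a : Fin 3 → ℤ) (x y : V3) :
    dotZR a (x - y) = dotZR a x - dotZR a y := by
  simp [dotZR, Fin.sum_univ_three]; ring

lemma dot_add_right (a : Fin 3 → ℤ) (x y : V3) :
    dotZR a (x + y) = dotZR a x + dotZR a y := by
  simp [dotZR, Fin.sum_univ_three]; ring

lemma adelta_finite (δ : ℕ) : (Adelta δ).Finite := by
  apply Set.Finite.subset (Set.finite_Icc (0 : Fin 3 → ℤ) (fun _ => (δ : ℤ)))
  rintro a ⟨h0, h1⟩
  have e0 := h0 0
  have e1 := h0 1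
  have e2 := h0 2
  refine ⟨fun i => h0 i, fun i => ?_⟩
  fin_cases i <;> simp <;> omega

instance adelta_finite_inst (δ : ℕ) : Finite (Adelta δ) := (adelta_finite δ).to_subtype

lemma zero_mem_adelta (δ : ℕ) : (0 : Fin 3 → ℤ) ∈ Adelta δ := by
  simp [Adelta]

lemma sarg_nonempty (δ : ℕ) (lam : (Fin 3 → ℤ) → ℝ) (x : V3) : (Sarg δ lam x).Nonempty := by
  obtain ⟨a, ha, h⟩ := Set.exists_max_image (Adelta δ) (fun a => lam a + dotZR a x)
    (adelta_finite δ) ⟨0, zero_mem_adelta δ⟩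
  exact ⟨a, ha, h⟩

lemma sarg_eq_val {δ : ℕ} {lam : (Fin 3 → ℤ) → ℝ} {x : V3} {a b : Fin 3 → ℤ}
    (ha : a ∈ Sarg δ lam x) (hb : b ∈ Sarg δ lam x) :
    lam a + dotZR a x = lam b + dotZR b x :=
  le_antisymm (hb.2 a ha.1) (ha.2 b hb.1)

lemma sarg_of_le {δ : ℕ} {lam : (Fin 3 → ℤ) → ℝ} {x : V3} {a b : Fin 3 → ℤ}
    (ha : a ∈ Sarg δ lam x) (hb : b ∈ Adelta δ)
    (h : lam a + dotZR a x ≤ lam b + dotZR b x) : b ∈ Sarg δ lam x :=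
  ⟨hb, fun c hc => (ha.2 c hc).trans h⟩

/-- points common to the argmax at two points are in the argmax at convex combinations -/
lemma sarg_conv {δ : ℕ} {lam : (Fin 3 → ℤ) → ℝ} {x y : V3} {b : Fin 3 → ℤ} {p q : ℝ}
    (hx : b ∈ Sarg δ lam x) (hy : b ∈ Sarg δ lam y) (hp : 0 ≤ p) (hq : 0 ≤ q) (hpq : p + q = 1) :
    b ∈ Sarg δ lam (p • x + q • y) := by
  refine ⟨hx.1, fun c hc => ?_⟩
  rw [dot_comb, dot_comb]
  have h1 := mul_le_mul_of_nonneg_left (hx.2 c hc) hp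
  have h2 := mul_le_mul_of_nonneg_left (hy.2 c hc) hq
  have e : q = 1 - p := by linarith
  subst e
  nlinarith

lemma sarg_closed1 (δ : ℕ) (lam : (Fin 3 → ℤ) → ℝ) (v d : V3) (b : Fin 3 → ℤ) :
    IsClosed {s : ℝ | b ∈ Sarg δ lam (v + s • d)} := by
  have : {s : ℝ | b ∈ Sarg δ lam (v + s • d)} = {s : ℝ | b ∈ Adelta δ} ∩
      ⋂ c ∈ Adelta δ, {s : ℝ | lam c + dotZR c (v + s • d) ≤ lam b + dotZR b (v + s • d)} := by
    ext s; simp [Sarg]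
  rw [this]
  refine IsClosed.inter isClosed_const (isClosed_biInter fun c _ => ?_)
  simp only [dot_line]
  exact isClosed_le (by fun_prop) (by fun_prop)

lemma sarg_closed (δ : ℕ) (lam : (Fin 3 → ℤ) → ℝ) (v d : V3) (P : (Fin 3 → ℤ) → Prop) :
    IsClosed {s : ℝ | ∃ b ∈ Sarg δ lam (v + s • d), P b} := by
  have : {s : ℝ | ∃ b ∈ Sarg δ lam (v + s • d), P b} =
      ⋃ b ∈ {b | b ∈ Adelta δ ∧ P b}, {s : ℝ | b ∈ Sarg δ lam (v + s • d)} := by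
    ext s
    simp only [Set.mem_ofPred_eq, Set.mem_iUnion, exists_prop]
    constructor
    · rintro ⟨b, h1, h2⟩; exact ⟨b, ⟨h1.1, h2⟩, h1⟩
    · rintro ⟨b, ⟨_, h2⟩, h1⟩; exact ⟨b, h1, h2⟩
  rw [this]
  exact ((adelta_finite δ).subset (fun b hb => hb.1)).isClosed_biUnion
    fun b _ => sarg_closed1 δ lam v d b

/-! ### Parametrised pieces of a tropical line -/

/-- parameter range of a ray (`none`) or a segment (`some t`) -/
def JJ : Option ℝ → Set ℝ
  | none => Set.Ici 0
  | some t => Set.Icc 0 t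

lemma JJ_nonneg {τ : Option ℝ} {s : ℝ} (h : s ∈ JJ τ) : 0 ≤ s := by
  cases τ with
  | none => exact h
  | some t => exact h.1

lemma JJ_down {τ : Option ℝ} {s r : ℝ} (h : s ∈ JJ τ) (hr : 0 ≤ r) (hrs : r ≤ s) : r ∈ JJ τ := by
  cases τ with
  | none => exact hr
  | some t => exact ⟨hr, hrs.trans h.2⟩

lemma JJ_closed (τ : Option ℝ) : IsClosed (JJ τ) := by
  cases τ with
  | none => exact isClosed_Ici
  | some t => exact isClosed_Icc

lemma exists_good_param (δ : ℕ) (lam : (Fin 3 → ℤ) → ℝ) (v d : V3) (τ : Option ℝ)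
    (hτ : ∀ t, τ = some t → 0 ≤ t)
    (hV : ∀ s ∈ JJ τ, v + s • d ∈ Vtrop δ lam) (a : Fin 3 → ℤ) (ha : a ∈ Adelta δ) :
    ∃ s ∈ JJ τ,
      (τ = some s ∨ ∃ b ∈ Sarg δ lam (v + s • d), b ≠ a ∧ dotZR a d ≤ dotZR b d) ∧
      (s = 0 ∨ ∃ b ∈ Sarg δ lam (v + s • d), b ≠ a ∧ dotZR b d ≤ dotZR a d) := by
  have hV' : ∀ s ∈ JJ τ, ∃ b ∈ Sarg δ lam (v + s • d), b ≠ a := by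
    intro s hs
    obtain ⟨b, hb, c, hc, hbc⟩ := hV s hs
    by_cases h : b = a
    · exact ⟨c, hc, fun h' => hbc (h.trans h'.symm)⟩
    · exact ⟨b, hb, h⟩
  set C : Set ℝ := JJ τ ∩ {s | ∃ b ∈ Sarg δ lam (v + s • d), b ≠ a ∧ dotZR a d ≤ dotZR b d} with hC
  have hCc : IsClosed C := (JJ_closed τ).inter (sarg_closed δ lam v d _)
  rcases C.eq_empty_or_nonempty with hE | hN
  · have hlow : ∀ s ∈ JJ τ, ∃ b ∈ Sarg δ lam (v + s • d), b ≠ a ∧ dotZR b d < dotZR a d := by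
      intro s hs
      obtain ⟨b, hb, hba⟩ := hV' s hs
      refine ⟨b, hb, hba, ?_⟩
      by_contra hcon
      have : s ∈ C := ⟨hs, b, hb, hba, not_lt.mp hcon⟩
      rw [hE] at this; exact this
    cases τ with
    | some t =>
      have ht : t ∈ JJ (some t) := ⟨hτ t rfl, le_refl t⟩
      obtain ⟨b, hb, hba, hl⟩ := hlow t ht
      exact ⟨t, ht, Or.inl rfl, Or.inr ⟨b, hb, hba, hl.le⟩⟩
    | none =>
      exfalso
      -- for large s the point a wins over everything of smaller slope
      have hev : ∀ b ∈ Adelta δ, dotZR b d < dotZR a d →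
          ∀ᶠ s : ℝ in Filter.atTop,
            lam b + dotZR b (v + s • d) < lam a + dotZR a (v + s • d) := by
        intro b _ hlt
        filter_upwards [Filter.eventually_gt_atTop
          ((lam b + dotZR b v - lam a - dotZR a v) / (dotZR a d - dotZR b d))] with s hs
        rw [div_lt_iff₀ (by linarith)] at hs
        rw [dot_line, dot_line]; linarith
      have hall : ∀ᶠ s : ℝ in Filter.atTop, ∀ b ∈ Adelta δ, dotZR b d < dotZR a d →
            lam b + dotZR b (v + s • d) < lam a + dotZR a (v + s • d) := by
        rw [Filter.eventually_all_finite (adelta_finite δ)]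
        intro b hb
        by_cases h : dotZR b d < dotZR a d
        · filter_upwards [hev b hb h] with s hs _ using hs
        · exact Filter.Eventually.of_forall fun s h' => absurd h' h
      obtain ⟨s, hs, hs0⟩ := (hall.and (Filter.eventually_ge_atTop 0)).exists
      obtain ⟨b, hb, _, hl⟩ := hlow s hs0
      exact absurd (hb.2 a ha) (not_le.mpr (hs b hb.1 hl))
  · have hbdd : BddBelow C := ⟨0, fun s hs => JJ_nonneg hs.1⟩
    set s0 := sInf C with hs0
    have hs0C : s0 ∈ C := hCc.csInf_mem hN hbdd
    refine ⟨s0, hs0C.1, Or.inr hs0C.2, ?_⟩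
    by_cases hz : s0 = 0
    · exact Or.inl hz
    right
    have hpos : 0 < s0 := lt_of_le_of_ne (JJ_nonneg hs0C.1) (Ne.symm hz)
    have hsub : Set.Ico 0 s0 ⊆
        {s | ∃ b ∈ Sarg δ lam (v + s • d), b ≠ a ∧ dotZR b d ≤ dotZR a d} := by
      rintro s ⟨h0, h1⟩
      have hsJ := JJ_down hs0C.1 h0 h1.le
      obtain ⟨b, hb, hba⟩ := hV' s hsJ
      refine ⟨b, hb, hba, ?_⟩
      by_contra hcon
      have : s ∈ C := ⟨hsJ, b, hb, hba, (not_le.mp hcon).le⟩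
      exact absurd (csInf_le hbdd this) (not_le.mpr h1)
    have := closure_minimal hsub (sarg_closed δ lam v d _)
    rw [closure_Ico (ne_of_lt hpos)] at this
    exact this ⟨hpos.le, le_refl _⟩

/-- The combinatorial type of a ray or a segment. -/
def Ty (δ : ℕ) (lam : (Fin 3 → ℤ) → ℝ) (v d : V3) (τ : Option ℝ) :
    Set (Set (Adelta δ) × Prop × Prop) :=
  {q | ∃ s ∈ JJ τ, q = ((Subtype.val ⁻¹' Sarg δ lam (v + s • d) : Set (Adelta δ)), s = 0,
    τ = some s)}

lemma sarg_preimage_eq {δ : ℕ} {lam : (Fin 3 → ℤ) → ℝ} {x y : V3}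
    (h : (Subtype.val ⁻¹' Sarg δ lam x : Set (Adelta δ)) = Subtype.val ⁻¹' Sarg δ lam y) :
    Sarg δ lam x = Sarg δ lam y := by
  ext a
  constructor
  · intro ha
    have : (⟨a, ha.1⟩ : Adelta δ) ∈ (Subtype.val ⁻¹' Sarg δ lam x : Set (Adelta δ)) := ha
    rw [h] at this; exact this
  · intro ha
    have : (⟨a, ha.1⟩ : Adelta δ) ∈ (Subtype.val ⁻¹' Sarg δ lam y : Set (Adelta δ)) := ha
    rw [← h] at this; exact this

lemma Ty_transfer {δ : ℕ} {lam : (Fin 3 → ℤ) → ℝ} {v0 v1 d : V3} {τ0 τ1 : Option ℝ}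
    (h : Ty δ lam v0 d τ0 = Ty δ lam v1 d τ1) {s0 : ℝ} (hs : s0 ∈ JJ τ0) :
    ∃ s1 ∈ JJ τ1, Sarg δ lam (v0 + s0 • d) = Sarg δ lam (v1 + s1 • d) ∧ (s0 = 0 ↔ s1 = 0) ∧
      (τ0 = some s0 ↔ τ1 = some s1) := by
  have hm : ((Subtype.val ⁻¹' Sarg δ lam (v0 + s0 • d) : Set (Adelta δ)), s0 = 0,
    τ0 = some s0) ∈ Ty δ lam v0 d τ0 := ⟨s0, hs, rfl⟩
  rw [h] at hm
  obtain ⟨s1, hs1, he⟩ := hm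
  simp only [Prod.mk.injEq] at he
  exact ⟨s1, hs1, sarg_preimage_eq he.1, iff_of_eq he.2.1, iff_of_eq he.2.2⟩

/-- Interpolating between two pieces of the same type stays inside the surface. -/
lemma interp (δ : ℕ) (lam : (Fin 3 → ℤ) → ℝ) (v0 v1 d : V3) (τ0 τ1 : Option ℝ)
    (hτ : ∀ t, τ0 = some t → 0 ≤ t)
    (hV : ∀ s ∈ JJ τ0, v0 + s • d ∈ Vtrop δ lam)
    (hT : Ty δ lam v0 d τ0 = Ty δ lam v1 d τ1)
    (p q : ℝ) (hp : 0 ≤ p) (hq : 0 ≤ q) (hpq : p + q = 1) (s : ℝ) (hs : 0 ≤ s)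
    (hst : ∀ t0 t1, τ0 = some t0 → τ1 = some t1 → s ≤ p * t0 + q * t1) :
    (p • v0 + q • v1) + s • d ∈ Vtrop δ lam := by
  set y : V3 := (p • v0 + q • v1) + s • d with hy
  obtain ⟨a, ha⟩ := sarg_nonempty δ lam y
  by_contra hcon
  have huniq : ∀ b ∈ Sarg δ lam y, b = a := by
    intro b hb
    by_contra hba
    exact hcon ⟨b, hb, a, ha, hba⟩
  obtain ⟨s0, hs0, hR, hL⟩ := exists_good_param δ lam v0 d τ0 hτ hV a ha.1
  obtain ⟨s1, hs1, hS, h0, h1⟩ := Ty_transfer hT hs0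
  have key : ∀ b ∈ Sarg δ lam (v0 + s0 • d), b ≠ a →
      0 ≤ (s - (p * s0 + q * s1)) * (dotZR b d - dotZR a d) → False := by
    intro b hb hba hsl
    have hb1 : b ∈ Sarg δ lam (v1 + s1 • d) := hS ▸ hb
    have hb' := sarg_conv hb hb1 hp hq hpq
    have e : p • (v0 + s0 • d) + q • (v1 + s1 • d) = (p • v0 + q • v1) + (p * s0 + q * s1) • d := by
      module
    rw [e] at hb'
    have hle := hb'.2 a ha.1
    rw [dot_line a _ d, dot_line b _ d] at hle
    refine hba (huniq b (sarg_of_le ha hb.1 ?_))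
    rw [hy, dot_line a _ d, dot_line b _ d]
    nlinarith
  rcases lt_trichotomy s (p * s0 + q * s1) with hlt | heq | hgt
  · rcases hL with hL | ⟨b, hb, hba, hsl⟩
    · have := h0.1 hL
      subst hL; subst this
      simp at hlt; linarith
    · exact key b hb hba (by nlinarith)
  · obtain ⟨b, hb, c, hc, hbc⟩ := hV s0 hs0
    by_cases h : b = a
    · exact key c hc (fun h' => hbc (h.trans h'.symm)) (by rw [heq]; simp)
    · exact key b hb h (by rw [heq]; simp)
  · rcases hR with hR | ⟨b, hb, hba, hsl⟩
    · have := hst s0 s1 hR (h1.1 hR)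
      linarith
    · exact key b hb hba (by nlinarith)

/-! ### Consequences of smoothness -/

lemma ai_weights {δ : ℕ} {lam : (Fin 3 → ℤ) → ℝ} (hsm : TropSmooth δ lam) {x : V3}
    (F : Finset (Fin 3 → ℤ)) (hF : ∀ a ∈ F, a ∈ Sarg δ lam x) (w : (Fin 3 → ℤ) → ℝ)
    (h0 : ∑ a ∈ F, w a = 0) (h1 : ∑ a ∈ F, w a • zToR a = 0) : ∀ a ∈ F, w a = 0 := by
  classical
  have h := (hsm x).1
  rw [affineIndependent_iff] at h
  have hh := h (F.subtype (fun a => a ∈ Sarg δ lam x)) (fun a => w a.1) ?_ ?_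
  · intro a ha
    exact hh ⟨a, hF a ha⟩ (by simpa using ha)
  · rw [← h0]
    exact Finset.sum_subtype_of_mem (p := fun a => a ∈ Sarg δ lam x) w hF
  · rw [← h1]
    exact Finset.sum_subtype_of_mem (p := fun a => a ∈ Sarg δ lam x) (fun a => w a • zToR a) hF

lemma zToR_inj {a b : Fin 3 → ℤ} (h : zToR a = zToR b) : a = b := by
  funext i
  have := congrFun h i
  simpa [zToR] using this

lemma sarg_ncard_le {δ : ℕ} {lam : (Fin 3 → ℤ) → ℝ} (hsm : TropSmooth δ lam) (x : V3) :
    (Sarg δ lam x).ncard ≤ 4 := by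
  have hf : (Sarg δ lam x).Finite := (adelta_finite δ).subset fun a h => h.1
  have := hf.fintype
  have h := (hsm x).1.card_le_finrank_succ
  have h2 := Submodule.finrank_le (vectorSpan ℝ (Set.range fun a : Sarg δ lam x => zToR a.1))
  have h3 : Module.finrank ℝ (Fin 3 → ℝ) = 3 := by simp
  rw [Set.ncard_eq_toFinset_card', Set.toFinset_card]
  omega

/-- four distinct elements of an argmax set are a unimodular tetrahedron -/
lemma sarg_det {δ : ℕ} {lam : (Fin 3 → ℤ) → ℝ} (hsm : TropSmooth δ lam) {x : V3}
    {a b c e : Fin 3 → ℤ} (ha : a ∈ Sarg δ lam x) (hb : b ∈ Sarg δ lam x)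
    (hc : c ∈ Sarg δ lam x) (he : e ∈ Sarg δ lam x)
    (hab : a ≠ b) (hac : a ≠ c) (hae : a ≠ e) (hbc : b ≠ c) (hbe : b ≠ e) (hce : c ≠ e) :
    |detZ (b - a) (c - a) (e - a)| = 1 := by
  have hf : (Sarg δ lam x).Finite := (adelta_finite δ).subset fun a h => h.1
  have hcard : ({a, b, c, e} : Set (Fin 3 → ℤ)).ncard = 4 := by
    rw [Set.ncard_insert_of_notMem (by simp [hab, hac, hae]),
      Set.ncard_insert_of_notMem (by simp [hbc, hbe]), Set.ncard_pair hce]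
  have hsub : ({a, b, c, e} : Set (Fin 3 → ℤ)) ⊆ Sarg δ lam x := by
    intro z hz
    rcases hz with rfl | rfl | rfl | rfl <;> assumption
  have heq := Set.eq_of_subset_of_ncard_le hsub (by rw [hcard]; exact sarg_ncard_le hsm x) hf
  exact (hsm x).2 a b c e heq.symm (by rw [← heq, hcard])

lemma detZ_eq (u v w : Fin 3 → ℤ) : detZ u v w =
    u 0 * v 1 * w 2 - u 0 * v 2 * w 1 - u 1 * v 0 * w 2 + u 1 * v 2 * w 0
      + u 2 * v 0 * w 1 - u 2 * v 1 * w 0 := by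
  simp [detZ, Matrix.det_fin_three]

/-- if an argmax set is orthogonal to a nonzero vector it does not have 4 elements -/
lemma no_four {δ : ℕ} {lam : (Fin 3 → ℤ) → ℝ} (hsm : TropSmooth δ lam) {x u : V3} (hu : u ≠ 0)
    (hperp : ∀ a ∈ Sarg δ lam x, ∀ b ∈ Sarg δ lam x, dotZR a u = dotZR b u)
    {a b c e : Fin 3 → ℤ} (ha : a ∈ Sarg δ lam x) (hb : b ∈ Sarg δ lam x)
    (hc : c ∈ Sarg δ lam x) (he : e ∈ Sarg δ lam x)
    (hab : a ≠ b) (hac : a ≠ c) (hae : a ≠ e) (hbc : b ≠ c) (hbe : b ≠ e) (hce : c ≠ e) :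
    False := by
  have hdet := sarg_det hsm ha hb hc he hab hac hae hbc hbe hce
  have hdet0 : detZ (b - a) (c - a) (e - a) ≠ 0 := by
    intro h; rw [h] at hdet; simp at hdet
  have hR : ((detZ (b - a) (c - a) (e - a) : ℤ) : ℝ) ≠ 0 := by exact_mod_cast hdet0
  rw [detZ_eq] at hR
  push_cast at hR
  have e1 := hperp b hb a ha
  have e2 := hperp c hc a ha
  have e3 := hperp e he a ha
  simp only [dotZR, Fin.sum_univ_three] at e1 e2 e3
  simp only [Pi.sub_apply, Int.cast_sub] at hR
  generalize (a 0 : ℝ) = a0 at *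
  generalize (a 1 : ℝ) = a1 at *
  generalize (a 2 : ℝ) = a2 at *
  generalize (b 0 : ℝ) = b0 at *
  generalize (b 1 : ℝ) = b1 at *
  generalize (b 2 : ℝ) = b2 at *
  generalize (c 0 : ℝ) = c0 at *
  generalize (c 1 : ℝ) = c1 at *
  generalize (c 2 : ℝ) = c2 at *
  generalize (e 0 : ℝ) = f0 at *
  generalize (e 1 : ℝ) = f1 at *
  generalize (e 2 : ℝ) = f2 at *
  apply hu
  have z0 : u 0 = 0 := by
    apply (mul_eq_zero.mp _).resolve_left hR
    linear_combination ((c1-a1)*(f2-a2) - (c2-a2)*(f1-a1)) * e1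
      - ((b1-a1)*(f2-a2) - (b2-a2)*(f1-a1)) * e2 + ((b1-a1)*(c2-a2) - (b2-a2)*(c1-a1)) * e3
  have z1 : u 1 = 0 := by
    apply (mul_eq_zero.mp _).resolve_left hR
    linear_combination -((c0-a0)*(f2-a2) - (c2-a2)*(f0-a0)) * e1
      + ((b0-a0)*(f2-a2) - (b2-a2)*(f0-a0)) * e2 - ((b0-a0)*(c2-a2) - (b2-a2)*(c0-a0)) * e3
  have z2 : u 2 = 0 := by
    apply (mul_eq_zero.mp _).resolve_left hR
    linear_combination ((c0-a0)*(f1-a1) - (c1-a1)*(f0-a0)) * e1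
      - ((b0-a0)*(f1-a1) - (b1-a1)*(f0-a0)) * e2 + ((b0-a0)*(c1-a1) - (b1-a1)*(c0-a0)) * e3
  funext i
  fin_cases i <;> simp [z0, z1, z2]

/-- a triangle of the dual subdivision is part of a unimodular tetrahedron -/
lemma prim_triangle {δ : ℕ} (hδ : 1 ≤ δ) {lam : (Fin 3 → ℤ) → ℝ} (hsm : TropSmooth δ lam)
    {x u : V3} (hu : u ≠ 0)
    (hperp : ∀ a ∈ Sarg δ lam x, ∀ b ∈ Sarg δ lam x, dotZR a u = dotZR b u)
    {a b c : Fin 3 → ℤ} (ha : a ∈ Sarg δ lam x) (hb : b ∈ Sarg δ lam x)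
    (hc : c ∈ Sarg δ lam x) (hab : a ≠ b) (hac : a ≠ c) (hbc : b ≠ c) :
    ∃ e, |detZ (b - a) (c - a) (e - a)| = 1 := by
  -- a direction increasing some lattice point over `a`
  obtain ⟨n, hpn, f, hf, hlt⟩ : ∃ n : V3,
      (∀ a ∈ Sarg δ lam x, ∀ b ∈ Sarg δ lam x, dotZR a n = dotZR b n) ∧
      ∃ f ∈ Adelta δ, dotZR a n < dotZR f n := by
    have hex : ∃ f ∈ Adelta δ, dotZR a u ≠ dotZR f u := by
      by_contra hcon
      push Not at hcon
      apply hu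
      have h0 := hcon 0 (zero_mem_adelta δ)
      have hm : ∀ i : Fin 3, (Pi.single i 1 : Fin 3 → ℤ) ∈ Adelta δ := by
        intro i
        constructor
        · intro j; by_cases h : j = i
          · subst h; simp
          · simp [h]
        · fin_cases i <;> simp [Pi.single_apply] <;> omega
      have z : dotZR 0 u = 0 := by simp [dotZR]
      funext i
      have hi := hcon _ (hm i)
      have : dotZR (Pi.single i 1) u = u i := by
        fin_cases i <;> simp [dotZR, Fin.sum_univ_three, Pi.single_apply]
      rw [this, h0, z] at hi
      simpa using hi.symm
    obtain ⟨f, hf, hne⟩ := hex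
    rcases lt_or_gt_of_ne hne with h | h
    · exact ⟨u, hperp, f, hf, h⟩
    · have hneg : ∀ g : Fin 3 → ℤ, dotZR g (-u) = - dotZR g u := by
        intro g; simp [dotZR]
      refine ⟨-u, fun a ha b hb => by rw [hneg, hneg, hperp a ha b hb], f, hf, ?_⟩
      rw [hneg, hneg]; linarith
  set K : Set ℝ := {s | 0 ≤ s} ∩ {s | a ∈ Sarg δ lam (x + s • n)} with hK
  have hKc : IsClosed K := IsClosed.inter isClosed_Ici (sarg_closed1 δ lam x n a)
  have hKn : K.Nonempty := ⟨0, le_refl (0 : ℝ), by simpa using ha⟩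
  have hKb : BddAbove K := by
    refine ⟨(lam a + dotZR a x - lam f - dotZR f x) / (dotZR f n - dotZR a n), ?_⟩
    rintro s ⟨_, hs⟩
    have := hs.2 f hf
    rw [dot_line, dot_line] at this
    rw [le_div_iff₀ (by linarith)]; linarith
  set s0 := sSup K with hs0
  have hmem : s0 ∈ K := hKc.csSup_mem hKn hKb
  have haS := hmem.2
  have htrans : ∀ z ∈ Sarg δ lam x, z ∈ Sarg δ lam (x + s0 • n) := by
    intro z hz
    refine sarg_of_le haS hz.1 ?_
    have h1 := sarg_eq_val ha hz
    have h2 := hpn a ha z hz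
    rw [dot_line, dot_line, h2]; linarith
  have hsub : Set.Ioi s0 ⊆ {s | ∃ e ∈ Sarg δ lam (x + s • n), dotZR a n < dotZR e n} := by
    intro s hs
    have hs' : s0 < s := hs
    have hna : a ∉ Sarg δ lam (x + s • n) := by
      intro h
      have : s ∈ K := ⟨le_trans hmem.1 hs'.le, h⟩
      exact absurd (le_csSup hKb this) (not_le.mpr hs')
    obtain ⟨e, he⟩ := sarg_nonempty δ lam (x + s • n)
    refine ⟨e, he, ?_⟩
    have h1 : lam a + dotZR a (x + s • n) < lam e + dotZR e (x + s • n) := by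
      by_contra hcon
      exact hna (sarg_of_le he ha.1 (not_lt.mp hcon))
    have h2 := haS.2 e he.1
    rw [dot_line, dot_line] at h1 h2
    by_contra hcon
    nlinarith
  have hcl := closure_minimal hsub (sarg_closed δ lam x n _)
  rw [closure_Ioi] at hcl
  obtain ⟨e, he, hel⟩ := hcl (Set.mem_Ici.mpr (le_refl s0))
  have hne : ∀ z ∈ Sarg δ lam x, z ≠ e := by
    intro z hz h
    have := hpn a ha z hz
    rw [h] at this; linarith
  exact ⟨e, sarg_det hsm (htrans a ha) (htrans b hb) (htrans c hc) he hab hac (hne a ha) hbc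
    (hne b hb) (hne c hc)⟩

lemma cross_zero {p q : V3} (hp : p ≠ 0) (h0 : p 1 * q 2 - p 2 * q 1 = 0)
    (h1 : p 2 * q 0 - p 0 * q 2 = 0) (h2 : p 0 * q 1 - p 1 * q 0 = 0) : ∃ c : ℝ, q = c • p := by
  have : p 0 ≠ 0 ∨ p 1 ≠ 0 ∨ p 2 ≠ 0 := by
    by_contra hcon
    push Not at hcon
    apply hp; funext i; fin_cases i <;> simp [hcon]
  rcases this with h | h | h
  · refine ⟨q 0 / p 0, ?_⟩
    funext i; fin_cases i <;> simp <;> field_simp <;> linarith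
  · refine ⟨q 1 / p 1, ?_⟩
    funext i; fin_cases i <;> simp <;> field_simp <;> linarith
  · refine ⟨q 2 / p 2, ?_⟩
    funext i; fin_cases i <;> simp <;> field_simp <;> linarith

/-- two edges of an argmax set orthogonal to the same plane coincide -/
lemma edge_unique {δ : ℕ} {lam : (Fin 3 → ℤ) → ℝ} (hsm : TropSmooth δ lam) {x y d : V3}
    (hd : d ≠ 0) (hpar : ∀ c : ℝ, y ≠ c • d)
    {a b c e : Fin 3 → ℤ} (ha : a ∈ Sarg δ lam x) (hb : b ∈ Sarg δ lam x)
    (hc : c ∈ Sarg δ lam x) (he : e ∈ Sarg δ lam x) (hab : a ≠ b) (hce : c ≠ e)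
    (h1 : dotZR a y = dotZR b y) (h2 : dotZR a d = dotZR b d)
    (h3 : dotZR c y = dotZR e y) (h4 : dotZR c d = dotZR e d) :
    (a = c ∧ b = e) ∨ (a = e ∧ b = c) := by
  set p : V3 := zToR a - zToR b with hp
  set q : V3 := zToR c - zToR e with hq
  have hp0 : p ≠ 0 := fun h => hab (zToR_inj (sub_eq_zero.mp h))
  have hq0 : q ≠ 0 := fun h => hce (zToR_inj (sub_eq_zero.mp h))
  have k1 : p 0 * y 0 + p 1 * y 1 + p 2 * y 2 = 0 := by
    simp only [dotZR, Fin.sum_univ_three] at h1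
    simp only [hp, zToR, Pi.sub_apply]; linarith
  have k2 : p 0 * d 0 + p 1 * d 1 + p 2 * d 2 = 0 := by
    simp only [dotZR, Fin.sum_univ_three] at h2
    simp only [hp, zToR, Pi.sub_apply]; linarith
  have k3 : q 0 * y 0 + q 1 * y 1 + q 2 * y 2 = 0 := by
    simp only [dotZR, Fin.sum_univ_three] at h3
    simp only [hq, zToR, Pi.sub_apply]; linarith
  have k4 : q 0 * d 0 + q 1 * d 1 + q 2 * d 2 = 0 := by
    simp only [dotZR, Fin.sum_univ_three] at h4
    simp only [hq, zToR, Pi.sub_apply]; linarith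
  obtain ⟨r, hr⟩ : ∃ r : ℝ, q = r • p := by
    by_contra hcon
    set n : V3 := ![p 1 * q 2 - p 2 * q 1, p 2 * q 0 - p 0 * q 2, p 0 * q 1 - p 1 * q 0] with hn
    have hn0 : n ≠ 0 := by
      intro h
      apply hcon
      refine cross_zero hp0 ?_ ?_ ?_
      · simpa [hn] using congrFun h 0
      · simpa [hn] using congrFun h 1
      · simpa [hn] using congrFun h 2
    have n0 : n 0 = p 1 * q 2 - p 2 * q 1 := rfl
    have n1 : n 1 = p 2 * q 0 - p 0 * q 2 := rfl
    have n2 : n 2 = p 0 * q 1 - p 1 * q 0 := rfl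
    have par : ∀ z : V3, p 0 * z 0 + p 1 * z 1 + p 2 * z 2 = 0 →
        q 0 * z 0 + q 1 * z 1 + q 2 * z 2 = 0 → ∃ c : ℝ, z = c • n := by
      intro z e1 e2
      refine cross_zero hn0 ?_ ?_ ?_
      · rw [n1, n2]; linear_combination q 0 * e1 - p 0 * e2
      · rw [n0, n2]; linear_combination q 1 * e1 - p 1 * e2
      · rw [n0, n1]; linear_combination q 2 * e1 - p 2 * e2
    obtain ⟨c1, hc1⟩ := par y k1 k3
    obtain ⟨c2, hc2⟩ := par d k2 k4
    have hc20 : c2 ≠ 0 := by rintro rfl; apply hd; rw [hc2]; simp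
    apply hpar (c1 / c2)
    rw [hc1, hc2, smul_smul, div_mul_cancel₀ _ hc20]
  classical
  have hF : ∀ z ∈ ({a, b, c, e} : Finset (Fin 3 → ℤ)), z ∈ Sarg δ lam x := by
    intro z hz
    simp only [Finset.mem_insert, Finset.mem_singleton] at hz
    rcases hz with h | h | h | h <;> rw [h] <;> assumption
  have hw := ai_weights hsm ({a, b, c, e} : Finset (Fin 3 → ℤ)) hF
    (fun z => r * ((if z = a then 1 else 0) - (if z = b then 1 else 0))
      - ((if z = c then 1 else 0) - (if z = e then 1 else 0))) ?_ ?_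
  · have ea := hw a (by simp)
    have eb := hw b (by simp)
    have ec := hw c (by simp)
    have ee := hw e (by simp)
    by_cases hac : a = c
    · left; refine ⟨hac, ?_⟩
      by_contra hbe
      subst hac
      simp [hab, hab.symm, hce, hce.symm, hbe, Ne.symm hbe] at ea eb ec ee
    · right
      have hce' := hce.symm
      have hca := Ne.symm hac
      by_cases hcb : c = b
      · refine ⟨?_, hcb.symm⟩
        by_contra hae
        subst hcb
        simp [hab, hab.symm, hce, hce.symm, hae, Ne.symm hae] at ea eb ec ee
      · simp [hab, hab.symm, hce, hce.symm, hac, hca, hcb, Ne.symm hcb] at ea eb ec ee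
  · simp only [Finset.sum_sub_distrib, ← Finset.mul_sum, Finset.sum_ite_eq']
    simp
  · simp only [sub_smul, mul_smul, ite_smul, one_smul, zero_smul, Finset.sum_sub_distrib,
      ← Finset.smul_sum, Finset.sum_ite_eq']
    simp only [Finset.mem_insert, Finset.mem_singleton, true_or, or_true, if_true]
    have := hr
    rw [hp, hq] at this
    rw [this]; simp

/-! ### Edges along pieces that move sideways -/

lemma JJ_closure_diff {τ : Option ℝ} (hτ : ∀ t, τ = some t → 0 < t) {F : Set ℝ} (hF : F.Finite) :
    JJ τ ⊆ closure (JJ τ \ F) := by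
  have hd : Dense (Fᶜ) := hF.countable.dense_compl ℝ
  cases τ with
  | none =>
    have h := hd.open_subset_closure_inter (isOpen_Ioi (a := (0 : ℝ)))
    have h2 : Set.Ioi (0 : ℝ) ∩ Fᶜ ⊆ JJ none \ F := fun s hs =>
      ⟨show (0 : ℝ) ≤ s from le_of_lt hs.1, hs.2⟩
    have h3 := closure_minimal (h.trans (closure_mono h2)) isClosed_closure
    rwa [closure_Ioi] at h3
  | some t =>
    have h := hd.open_subset_closure_inter (isOpen_Ioo (a := (0 : ℝ)) (b := t))
    have h2 : Set.Ioo (0 : ℝ) t ∩ Fᶜ ⊆ JJ (some t) \ F :=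
      fun s hs => ⟨⟨le_of_lt hs.1.1, le_of_lt hs.1.2⟩, hs.2⟩
    have h3 := closure_minimal (h.trans (closure_mono h2)) isClosed_closure
    rwa [closure_Ioo (ne_of_lt (hτ t rfl))] at h3

lemma JJ_preconnected (τ : Option ℝ) : IsPreconnected (JJ τ) := by
  cases τ with
  | none => exact isPreconnected_Ici
  | some t => exact isPreconnected_Icc

lemma JJ_zero_mem {τ : Option ℝ} (hτ : ∀ t, τ = some t → 0 ≤ t) : (0 : ℝ) ∈ JJ τ := by
  cases τ with
  | none => exact le_refl (0 : ℝ)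
  | some t => exact ⟨le_refl _, hτ t rfl⟩

lemma sarg_perp {δ : ℕ} {lam : (Fin 3 → ℤ) → ℝ} {x y : V3} (h : Sarg δ lam x = Sarg δ lam y) :
    ∀ a ∈ Sarg δ lam x, ∀ b ∈ Sarg δ lam x, dotZR a (y - x) = dotZR b (y - x) := by
  intro a ha b hb
  have h1 := sarg_eq_val ha hb
  rw [h] at ha hb
  have h2 := sarg_eq_val ha hb
  rw [dot_sub_right, dot_sub_right]; linarith

lemma const_edge {δ : ℕ} {lam : (Fin 3 → ℤ) → ℝ} (hsm : TropSmooth δ lam) {v0 v1 d : V3}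
    {τ0 τ1 : Option ℝ} (hd : d ≠ 0) (hpar : ∀ c : ℝ, v1 - v0 ≠ c • d)
    (hτ : ∀ t, τ0 = some t → 0 < t)
    (hV : ∀ s ∈ JJ τ0, v0 + s • d ∈ Vtrop δ lam)
    (hT : Ty δ lam v0 d τ0 = Ty δ lam v1 d τ1) :
    ∃ a b : Fin 3 → ℤ, a ≠ b ∧ dotZR a d = dotZR b d ∧
      ∀ s ∈ JJ τ0, a ∈ Sarg δ lam (v0 + s • d) ∧ b ∈ Sarg δ lam (v0 + s • d) := by
  set K : (Fin 3 → ℤ) × (Fin 3 → ℤ) → Set ℝ := fun ab =>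
    JJ τ0 ∩ ({s | ab.1 ∈ Sarg δ lam (v0 + s • d)} ∩ {s | ab.2 ∈ Sarg δ lam (v0 + s • d)}) with hK
  have hKc : ∀ ab, IsClosed (K ab) := fun ab =>
    (JJ_closed τ0).inter ((sarg_closed1 δ lam v0 d _).inter (sarg_closed1 δ lam v0 d _))
  set AA : Set ((Fin 3 → ℤ) × (Fin 3 → ℤ)) := {ab | ab ∈ Adelta δ ×ˢ Adelta δ ∧ ab.1 ≠ ab.2}
    with hAA
  have hAAf : AA.Finite := ((adelta_finite δ).prod (adelta_finite δ)).subset fun _ h => h.1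
  set N : Set ((Fin 3 → ℤ) × (Fin 3 → ℤ)) := {ab | ab ∈ AA ∧ (K ab).Nontrivial} with hN
  have hNf : N.Finite := hAAf.subset fun _ h => h.1
  have hcov0 : ∀ s ∈ JJ τ0, ∃ ab ∈ AA, s ∈ K ab := by
    intro s hs
    obtain ⟨a, ha, b, hb, hab⟩ := hV s hs
    exact ⟨(a, b), ⟨⟨ha.1, hb.1⟩, hab⟩, hs, ha, hb⟩
  -- nontrivial pairs cover
  have hcov : JJ τ0 ⊆ ⋃ ab ∈ N, K ab := by
    set F : Set ℝ := ⋃ ab ∈ {ab | ab ∈ AA ∧ ¬ (K ab).Nontrivial}, K ab with hF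
    have hFf : F.Finite := by
      refine Set.Finite.biUnion (hAAf.subset fun _ h => h.1) ?_
      intro ab h
      exact (Set.not_nontrivial_iff.mp h.2).finite
    have hsub : JJ τ0 \ F ⊆ ⋃ ab ∈ N, K ab := by
      rintro s ⟨hs, hsF⟩
      obtain ⟨ab, h1, h2⟩ := hcov0 s hs
      by_cases h : (K ab).Nontrivial
      · exact Set.mem_biUnion (show ab ∈ N from ⟨h1, h⟩) h2
      · exact absurd (Set.mem_biUnion (show ab ∈ {ab | ab ∈ AA ∧ ¬ (K ab).Nontrivial} from
          ⟨h1, h⟩) h2) hsF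
    exact (JJ_closure_diff hτ hFf).trans
      (closure_minimal hsub (hNf.isClosed_biUnion fun ab _ => hKc ab))
  -- slopes on nontrivial pairs agree
  have hslope : ∀ ab ∈ N, dotZR ab.1 d = dotZR ab.2 d := by
    rintro ⟨a, b⟩ ⟨_, s, hs, s', hs', hne⟩
    have h1 := sarg_eq_val hs.2.1 hs.2.2
    have h2 := sarg_eq_val hs'.2.1 hs'.2.2
    rw [dot_line, dot_line] at h1 h2
    have h3 : (s - s') * (dotZR a d - dotZR b d) = 0 := by
      simp only at h1 h2
      linear_combination h1 - h2
    rcases mul_eq_zero.mp h3 with h | h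
    · exact absurd (sub_eq_zero.mp h) hne
    · exact sub_eq_zero.mp h
  have huniq : ∀ ab ∈ N, ∀ ce ∈ N, ∀ s, s ∈ K ab → s ∈ K ce →
      (ab.1 = ce.1 ∧ ab.2 = ce.2) ∨ (ab.1 = ce.2 ∧ ab.2 = ce.1) := by
    intro ab hab ce hce s h1 h2
    obtain ⟨s1, _, hS, _, _⟩ := Ty_transfer hT h1.1
    have hperp := sarg_perp hS
    refine edge_unique hsm hd (y := (v1 + s1 • d) - (v0 + s • d)) ?_ h1.2.1 h1.2.2 h2.2.1 h2.2.2
      hab.1.2 hce.1.2 (hperp _ h1.2.1 _ h1.2.2) (hslope ab hab) (hperp _ h2.2.1 _ h2.2.2)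
      (hslope ce hce)
    intro c hc
    apply hpar (c + s - s1)
    have : v1 - v0 = ((v1 + s1 • d) - (v0 + s • d)) + (s - s1) • d := by module
    rw [this, hc]; module
  have h0 : (0 : ℝ) ∈ JJ τ0 := JJ_zero_mem fun t ht => (hτ t ht).le
  obtain ⟨ab, habN, hab0⟩ := Set.mem_iUnion₂.mp (hcov h0)
  refine ⟨ab.1, ab.2, habN.1.2, hslope ab habN, ?_⟩
  set N' : Set ((Fin 3 → ℤ) × (Fin 3 → ℤ)) :=
    {ce | ce ∈ N ∧ ¬ ((ab.1 = ce.1 ∧ ab.2 = ce.2) ∨ (ab.1 = ce.2 ∧ ab.2 = ce.1))} with hN'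
  have hc' : IsClosed (⋃ ce ∈ N', K ce) :=
    (hNf.subset fun _ h => h.1).isClosed_biUnion fun ce _ => hKc ce
  have hcov2 : JJ τ0 ⊆ K ab ∪ ⋃ ce ∈ N', K ce := by
    intro s hs
    obtain ⟨ce, hceN, hces⟩ := Set.mem_iUnion₂.mp (hcov hs)
    by_cases h : (ab.1 = ce.1 ∧ ab.2 = ce.2) ∨ (ab.1 = ce.2 ∧ ab.2 = ce.1)
    · left
      rcases h with ⟨e1, e2⟩ | ⟨e1, e2⟩
      · refine ⟨hs, ?_, ?_⟩
        · show ab.1 ∈ Sarg δ lam (v0 + s • d)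
          rw [e1]; exact hces.2.1
        · show ab.2 ∈ Sarg δ lam (v0 + s • d)
          rw [e2]; exact hces.2.2
      · refine ⟨hs, ?_, ?_⟩
        · show ab.1 ∈ Sarg δ lam (v0 + s • d)
          rw [e1]; exact hces.2.2
        · show ab.2 ∈ Sarg δ lam (v0 + s • d)
          rw [e2]; exact hces.2.1
    · right
      exact Set.mem_biUnion (show ce ∈ N' from ⟨hceN, h⟩) hces
  have hpc := isPreconnected_closed_iff.mp (JJ_preconnected τ0) _ _ (hKc ab) hc' hcov2
    ⟨0, h0, hab0⟩
  intro s hs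
  rcases hcov2 hs with h | h
  · exact h.2
  · obtain ⟨r, _, hr1, hr2⟩ := hpc ⟨s, hs, h⟩
    obtain ⟨ce, hce, hces⟩ := Set.mem_iUnion₂.mp hr2
    exact absurd (huniq ab habN ce hce.1 r hr1 hces) hce.2

/-! ### Facets -/

/-- the four barycentric coordinates of a lattice point of `Γ_δ` -/
def mm (δ : ℕ) (a : Fin 3 → ℤ) : Fin 4 → ℤ := ![a 0, a 1, a 2, δ - a 0 - a 1 - a 2]

lemma mm_nonneg {δ : ℕ} {a : Fin 3 → ℤ} (ha : a ∈ Adelta δ) (i : Fin 4) : 0 ≤ mm δ a i := by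
  obtain ⟨h0, h1⟩ := ha
  have e0 := h0 0
  have e1 := h0 1
  have e2 := h0 2
  fin_cases i <;> simp [mm] <;> omega

lemma mm_dot (δ : ℕ) (a b : Fin 3 → ℤ) (i : Fin 4) :
    dotZR a (ωdir i) - dotZR b (ωdir i) = (mm δ b i : ℝ) - mm δ a i := by
  fin_cases i <;> simp [mm, dotZR, ωdir, Fin.sum_univ_three] <;> ring

lemma mm_inj {δ : ℕ} {a b : Fin 3 → ℤ} (h : ∀ i, mm δ a i = mm δ b i) : a = b := by
  have h0 := h 0
  have h1 := h 1
  have h2 := h 2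
  simp [mm] at h0 h1 h2
  funext i
  fin_cases i <;> simp [h0, h1, h2]

lemma exists_mm_zero (δ : ℕ) (i : Fin 4) : ∃ c ∈ Adelta δ, mm δ c i = 0 := by
  by_cases h : i = 3
  · subst h
    refine ⟨![δ, 0, 0], ⟨?_, by simp⟩, by simp [mm]⟩
    intro j; fin_cases j <;> simp
  · refine ⟨0, zero_mem_adelta δ, ?_⟩
    fin_cases i <;> simp [mm] at h ⊢

lemma ray_facet {δ : ℕ} {lam : (Fin 3 → ℤ) → ℝ} {v : V3} {i : Fin 4} {a : Fin 3 → ℤ}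
    (h : ∀ s : ℝ, 0 ≤ s → a ∈ Sarg δ lam (v + s • ωdir i)) : mm δ a i = 0 := by
  obtain ⟨c, hc, hc0⟩ := exists_mm_zero δ i
  have ha : a ∈ Adelta δ := (h 0 (le_refl _)).1
  by_contra hne
  have hpos : 1 ≤ mm δ a i := by have := mm_nonneg ha i; omega
  have hd := mm_dot δ c a i
  rw [hc0] at hd
  have hpos' : (1 : ℝ) ≤ mm δ a i := by exact_mod_cast hpos
  set M := |lam a + dotZR a v - lam c - dotZR c v| + 1 with hM
  have hM0 : 0 ≤ M := by positivity
  have := (h M hM0).2 c hc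
  rw [dot_line, dot_line] at this
  have habs := le_abs_self (lam a + dotZR a v - lam c - dotZR c v)
  push_cast at hd
  nlinarith

lemma perm_sum {M : Type*} [AddCommMonoid M] {i j k l : Fin 4}
    (h : ({i, j, k, l} : Finset (Fin 4)) = Finset.univ) (f : Fin 4 → M) :
    f i + f j + f k + f l = f 0 + f 1 + f 2 + f 3 := by
  have hd : i ≠ j ∧ i ≠ k ∧ i ≠ l ∧ j ≠ k ∧ j ≠ l ∧ k ≠ l := by
    revert h; revert i j k l; decide
  obtain ⟨h1, h2, h3, h4, h5, h6⟩ := hd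
  have e : ∑ x ∈ ({i, j, k, l} : Finset (Fin 4)), f x = ∑ x, f x := by rw [h]
  rw [Finset.sum_insert (by simp [h1, h2, h3]), Finset.sum_insert (by simp [h4, h5]),
    Finset.sum_pair h6, Fin.sum_univ_four] at e
  rw [← e]; simp only [add_assoc]

lemma mm_sum {δ : ℕ} {i j k l : Fin 4} (h : ({i, j, k, l} : Finset (Fin 4)) = Finset.univ)
    (a : Fin 3 → ℤ) : mm δ a i + mm δ a j + mm δ a k + mm δ a l = δ := by
  rw [perm_sum h]
  simp [mm]

lemma ω_sum {i j k l : Fin 4} (h : ({i, j, k, l} : Finset (Fin 4)) = Finset.univ) :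
    ωdir i + ωdir j + ωdir k + ωdir l = 0 := by
  rw [perm_sum h]
  funext x
  fin_cases x <;> simp [ωdir]

lemma ω_ne (i : Fin 4) : ωdir i ≠ 0 := by
  intro h
  have h0 := congrFun h 0
  have h1 := congrFun h 1
  have h2 := congrFun h 2
  fin_cases i <;> simp [ωdir] at h0 h1 h2

lemma ω_add_ne {i j k l : Fin 4} (h : ({i, j, k, l} : Finset (Fin 4)) = Finset.univ) :
    ωdir k + ωdir l ≠ 0 := by
  have hd : k ≠ l := by revert h; revert i j k l; decide
  intro h
  have h0 := congrFun h 0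
  have h1 := congrFun h 1
  have h2 := congrFun h 2
  clear * - hd h0 h1 h2
  fin_cases k <;> fin_cases l <;> simp [ωdir] at hd h0 h1 h2

lemma det_perm {δ : ℕ} {i j k l : Fin 4} (h : ({i, j, k, l} : Finset (Fin 4)) = Finset.univ)
    (a b c e : Fin 3 → ℤ) :
    |detZ (b - a) (c - a) (e - a)| =
      |detZ ![mm δ b i - mm δ a i, mm δ b j - mm δ a j, mm δ b k - mm δ a k]
        ![mm δ c i - mm δ a i, mm δ c j - mm δ a j, mm δ c k - mm δ a k]
        ![mm δ e i - mm δ a i, mm δ e j - mm δ a j, mm δ e k - mm δ a k]| := by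
  have hd : i ≠ j ∧ i ≠ k ∧ j ≠ k := by revert h; revert i j k l; decide
  clear h
  rw [abs_eq_abs, detZ_eq, detZ_eq]
  fin_cases i <;> fin_cases j <;> fin_cases k <;> simp at hd <;> simp [mm] <;>
    first
    | (left; ring1)
    | (right; ring1)

/-! ### Combinatorics at the vertices of a moving line -/

lemma mm_dot_eq {δ : ℕ} {a b : Fin 3 → ℤ} {i : Fin 4} (h : mm δ a i = mm δ b i) :
    dotZR a (ωdir i) = dotZR b (ωdir i) := by
  have := mm_dot δ a b i
  rw [h] at this
  linarith

lemma mm_of_dot {δ : ℕ} {a b : Fin 3 → ℤ} {k l : Fin 4}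
    (h : dotZR a (ωdir k + ωdir l) = dotZR b (ωdir k + ωdir l)) :
    mm δ a k + mm δ a l = mm δ b k + mm δ b l := by
  have h1 := mm_dot δ a b k
  have h2 := mm_dot δ a b l
  rw [dot_add_right, dot_add_right] at h
  have : (mm δ a k : ℝ) + mm δ a l = mm δ b k + mm δ b l := by linarith
  exact_mod_cast this

lemma mm_dot_add {δ : ℕ} {a b : Fin 3 → ℤ} {k l : Fin 4}
    (h : mm δ a k + mm δ a l = mm δ b k + mm δ b l) :
    dotZR a (ωdir k + ωdir l) = dotZR b (ωdir k + ωdir l) := by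
  have h1 := mm_dot δ a b k
  have h2 := mm_dot δ a b l
  rw [dot_add_right, dot_add_right]
  have : (mm δ a k : ℝ) + mm δ a l = mm δ b k + mm δ b l := by exact_mod_cast h
  linarith

lemma dvd_one_of_edge {δ : ℕ} {i j k l : Fin 4}
    (hP : ({i, j, k, l} : Finset (Fin 4)) = Finset.univ) {a b c e : Fin 3 → ℤ}
    (h1 : mm δ a i = 0) (h2 : mm δ b j = 0)
    (h3 : mm δ a i + mm δ a j = mm δ b i + mm δ b j)
    (h4 : mm δ c i = 0) (h5 : mm δ c j = 0)
    (hdet : |detZ (b - a) (c - a) (e - a)| = 1) : mm δ a i + mm δ a j ≤ 1 := by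
  rw [det_perm (δ := δ) hP] at hdet
  have h6 : mm δ b i = mm δ a j := by omega
  have hdv : mm δ a j ∣ 1 := by
    rw [← hdet, dvd_abs, detZ_eq]
    simp only [Matrix.cons_val_zero, Matrix.cons_val_one, Matrix.cons_val]
    rw [h1, h2, h4, h5, h6]
    refine ⟨-(mm δ a j) * (mm δ e k - mm δ a k) - (mm δ c k - mm δ a k) * (mm δ e j - mm δ a j)
      - (mm δ c k - mm δ a k) * mm δ e i + (mm δ b k - mm δ a k) * mm δ e i, ?_⟩
    ring
  have := Int.le_of_dvd one_pos hdv
  omega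

lemma vertex_le {δ : ℕ} (hδ : 3 ≤ δ) {lam : (Fin 3 → ℤ) → ℝ} (hsm : TropSmooth δ lam)
    {i j k l : Fin 4} (hP : ({i, j, k, l} : Finset (Fin 4)) = Finset.univ) {x u : V3}
    (hui : ∀ c : ℝ, u ≠ c • ωdir i) (huj : ∀ c : ℝ, u ≠ c • ωdir j)
    (hud : ∀ c : ℝ, u ≠ c • (ωdir k + ωdir l))
    (hperp : ∀ a ∈ Sarg δ lam x, ∀ b ∈ Sarg δ lam x, dotZR a u = dotZR b u)
    {a b p p' q q' : Fin 3 → ℤ} (ha : a ∈ Sarg δ lam x) (hb : b ∈ Sarg δ lam x) (hab : a ≠ b)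
    (habd : dotZR a (ωdir k + ωdir l) = dotZR b (ωdir k + ωdir l))
    (hp : p ∈ Sarg δ lam x) (hp' : p' ∈ Sarg δ lam x) (hpp : p ≠ p')
    (hq : q ∈ Sarg δ lam x) (hq' : q' ∈ Sarg δ lam x) (hqq : q ≠ q')
    (hp0 : mm δ p i = 0) (hp0' : mm δ p' i = 0)
    (hq0 : mm δ q j = 0) (hq0' : mm δ q' j = 0) : mm δ a i + mm δ a j ≤ 1 := by
  have hu : u ≠ 0 := fun h => hui 0 (by simp [h])
  have sum := fun z => mm_sum (δ := δ) hP z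
  have Fi : ∀ y ∈ Sarg δ lam x, ∀ z ∈ Sarg δ lam x, y ≠ z → mm δ y i = mm δ z i →
      mm δ y i = 0 := by
    intro y hy z hz hyz h
    rcases edge_unique hsm (ω_ne i) hui hy hz hp hp' hyz hpp (hperp _ hy _ hz) (mm_dot_eq h)
      (hperp _ hp _ hp') (mm_dot_eq (hp0.trans hp0'.symm)) with ⟨e1, _⟩ | ⟨e1, _⟩ <;> rw [e1] <;>
      assumption
  have Fj : ∀ y ∈ Sarg δ lam x, ∀ z ∈ Sarg δ lam x, y ≠ z → mm δ y j = mm δ z j →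
      mm δ y j = 0 := by
    intro y hy z hz hyz h
    rcases edge_unique hsm (ω_ne j) huj hy hz hq hq' hyz hqq (hperp _ hy _ hz) (mm_dot_eq h)
      (hperp _ hq _ hq') (mm_dot_eq (hq0.trans hq0'.symm)) with ⟨e1, _⟩ | ⟨e1, _⟩ <;> rw [e1] <;>
      assumption
  have hs : mm δ a i + mm δ a j = mm δ b i + mm δ b j := by
    have := mm_of_dot (δ := δ) habd
    have := sum a
    have := sum b
    omega
  have Fd : ∀ y ∈ Sarg δ lam x, ∀ z ∈ Sarg δ lam x, y ≠ z →
      mm δ y i + mm δ y j = mm δ z i + mm δ z j → (a = y ∧ b = z) ∨ (a = z ∧ b = y) := by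
    intro y hy z hz hyz h
    have h' : mm δ y k + mm δ y l = mm δ z k + mm δ z l := by
      have := sum y
      have := sum z
      omega
    exact edge_unique hsm (ω_add_ne hP) hud ha hb hy hz hab hyz (hperp _ ha _ hb) habd
      (hperp _ hy _ hz) (mm_dot_add h')
  by_cases hi : mm δ a i = mm δ b i
  · have e1 := Fi a ha b hb hab hi
    have e2 := Fj a ha b hb hab (by omega)
    omega
  · have hj : mm δ a j ≠ mm δ b j := by omega
    have aux : ∀ α : Fin 4, mm δ a α ≠ mm δ b α → ∀ y ∈ Sarg δ lam x, ∀ y' ∈ Sarg δ lam x,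
        y ≠ y' → mm δ y α = 0 → mm δ y' α = 0 →
        ∃ c ∈ Sarg δ lam x, c ≠ a ∧ c ≠ b ∧ mm δ c α = 0 ∧ (mm δ a α = 0 ∨ mm δ b α = 0) := by
      intro α hα y hy y' hy' hyy h0 h0'
      by_cases hya : y = a
      · subst hya
        refine ⟨y', hy', hyy.symm, ?_, h0', Or.inl h0⟩
        rintro rfl; exact hα (h0.trans h0'.symm)
      by_cases hyb : y = b
      · subst hyb
        refine ⟨y', hy', ?_, hyy.symm, h0', Or.inr h0⟩
        rintro rfl; exact hα (h0'.trans h0.symm)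
      refine ⟨y, hy, hya, hyb, h0, ?_⟩
      by_cases hya' : y' = a
      · subst hya'; exact Or.inl h0'
      by_cases hyb' : y' = b
      · subst hyb'; exact Or.inr h0'
      exact (no_four hsm hu hperp ha hb hy hy' hab (Ne.symm hya) (Ne.symm hya') (Ne.symm hyb)
        (Ne.symm hyb') hyy).elim
    obtain ⟨c, hc, hca, hcb, hc0, hi0⟩ := aux i hi p hp p' hp' hpp hp0 hp0'
    obtain ⟨c', hc', hca', hcb', hc0', hj0⟩ := aux j hj q hq q' hq' hqq hq0 hq0'
    have hcc : c = c' := by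
      by_contra hne
      exact no_four hsm hu hperp ha hb hc hc' hab hca.symm hca'.symm hcb.symm hcb'.symm hne
    subst hcc
    obtain ⟨e, he⟩ := prim_triangle (by omega) hsm hu hperp ha hb hc hab hca.symm hcb.symm
    have hP' : ({j, i, k, l} : Finset (Fin 4)) = Finset.univ := by
      rw [← hP]; exact Finset.insert_comm _ _ _
    rcases hi0 with hi0 | hi0 <;> rcases hj0 with hj0 | hj0
    · omega
    · exact dvd_one_of_edge hP hi0 hj0 hs hc0 hc0' he
    · have := dvd_one_of_edge hP' hj0 hi0 (by omega) hc0' hc0 he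
      omega
    · omega

lemma two_vertices {D : ℤ} {A B C : Fin 4 → ℤ} (hD : 0 < D)
    (hA : A 0 + A 1 + A 2 + A 3 = D) (hB : B 0 + B 1 + B 2 + B 3 = D)
    (hC : C 0 + C 1 + C 2 + C 3 = D)
    (h : ∀ α, (A α = 0 ∧ B α = 0) ∨ (A α = 0 ∧ C α = 0) ∨ (B α = 0 ∧ C α = 0)) :
    (∀ α, D ∣ A α) ∧ (∀ α, D ∣ B α) ∨ (∀ α, D ∣ A α) ∧ (∀ α, D ∣ C α) ∨
      (∀ α, D ∣ B α) ∧ (∀ α, D ∣ C α) := by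
  have key : ∀ X : Fin 4 → ℤ, ((X 0 = 0 ∨ X 0 = D) ∧ (X 1 = 0 ∨ X 1 = D) ∧ (X 2 = 0 ∨ X 2 = D) ∧
      (X 3 = 0 ∨ X 3 = D)) → ∀ α, D ∣ X α := by
    rintro X ⟨h0, h1, h2, h3⟩ α
    have : X α = 0 ∨ X α = D := by fin_cases α <;> assumption
    rcases this with h | h <;> rw [h] <;> simp
  have h0 := h 0
  have h1 := h 1
  have h2 := h 2
  have h3 := h 3
  clear h
  rcases h0 with h0 | h0 | h0 <;> rcases h1 with h1 | h1 | h1 <;>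
    rcases h2 with h2 | h2 | h2 <;> rcases h3 with h3 | h3 | h3 <;>
    first
    | (exfalso; omega)
    | exact Or.inl ⟨key A ⟨by omega, by omega, by omega, by omega⟩,
        key B ⟨by omega, by omega, by omega, by omega⟩⟩
    | exact Or.inr (Or.inl ⟨key A ⟨by omega, by omega, by omega, by omega⟩,
        key C ⟨by omega, by omega, by omega, by omega⟩⟩)
    | exact Or.inr (Or.inr ⟨key B ⟨by omega, by omega, by omega, by omega⟩,
        key C ⟨by omega, by omega, by omega, by omega⟩⟩)

lemma no_two_vertices {δ : ℕ} (hδ : 3 ≤ δ) {lam : (Fin 3 → ℤ) → ℝ} (hsm : TropSmooth δ lam)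
    {x u : V3} (hu : u ≠ 0)
    (hperp : ∀ a ∈ Sarg δ lam x, ∀ b ∈ Sarg δ lam x, dotZR a u = dotZR b u)
    {a b c : Fin 3 → ℤ} (ha : a ∈ Sarg δ lam x) (hb : b ∈ Sarg δ lam x)
    (hc : c ∈ Sarg δ lam x) (hab : a ≠ b) (hac : a ≠ c) (hbc : b ≠ c)
    (hA : ∀ α, (δ : ℤ) ∣ mm δ a α) (hB : ∀ α, (δ : ℤ) ∣ mm δ b α) : False := by
  obtain ⟨e, he⟩ := prim_triangle (by omega) hsm hu hperp ha hb hc hab hac hbc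
  rw [det_perm (δ := δ) (i := 0) (j := 1) (k := 2) (l := 3) (by decide)] at he
  have hd : (δ : ℤ) ∣ 1 := by
    rw [← he, dvd_abs, detZ_eq]
    simp only [Matrix.cons_val_zero, Matrix.cons_val_one, Matrix.cons_val]
    obtain ⟨r0, h0⟩ := dvd_sub (hB 0) (hA 0)
    obtain ⟨r1, h1⟩ := dvd_sub (hB 1) (hA 1)
    obtain ⟨r2, h2⟩ := dvd_sub (hB 2) (hA 2)
    rw [h0, h1, h2]
    refine Dvd.intro (r0 * (mm δ c 1 - mm δ a 1) * (mm δ e 2 - mm δ a 2)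
      - r0 * (mm δ c 2 - mm δ a 2) * (mm δ e 1 - mm δ a 1)
      - r1 * (mm δ c 0 - mm δ a 0) * (mm δ e 2 - mm δ a 2)
      + r1 * (mm δ c 2 - mm δ a 2) * (mm δ e 0 - mm δ a 0)
      + r2 * (mm δ c 0 - mm δ a 0) * (mm δ e 1 - mm δ a 1)
      - r2 * (mm δ c 1 - mm δ a 1) * (mm δ e 0 - mm δ a 0)) ?_
    ring
  have := Int.le_of_dvd one_pos hd
  omega

lemma vertex_zero {δ : ℕ} (hδ : 3 ≤ δ) {lam : (Fin 3 → ℤ) → ℝ} (hsm : TropSmooth δ lam)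
    {x u : V3} (hu : u ≠ 0)
    (hperp : ∀ a ∈ Sarg δ lam x, ∀ b ∈ Sarg δ lam x, dotZR a u = dotZR b u)
    (hE : ∀ α : Fin 4, ∃ a b : Fin 3 → ℤ, a ≠ b ∧ a ∈ Sarg δ lam x ∧ b ∈ Sarg δ lam x ∧
      mm δ a α = 0 ∧ mm δ b α = 0) : False := by
  have hP : ({0, 1, 2, 3} : Finset (Fin 4)) = Finset.univ := by decide
  have sum := fun z => mm_sum (δ := δ) hP z
  obtain ⟨a, b, hab, ha, hb, _, _⟩ := hE 0
  by_cases h3 : ∃ c ∈ Sarg δ lam x, c ≠ a ∧ c ≠ b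
  · obtain ⟨c, hc, hca, hcb⟩ := h3
    have hS : ∀ y ∈ Sarg δ lam x, y = a ∨ y = b ∨ y = c := by
      intro y hy
      by_contra hcon
      push Not at hcon
      exact no_four hsm hu hperp ha hb hc hy hab hca.symm (Ne.symm hcon.1) hcb.symm
        (Ne.symm hcon.2.1) (Ne.symm hcon.2.2)
    have h : ∀ α, (mm δ a α = 0 ∧ mm δ b α = 0) ∨ (mm δ a α = 0 ∧ mm δ c α = 0) ∨
        (mm δ b α = 0 ∧ mm δ c α = 0) := by
      intro α
      obtain ⟨y, z, hyz, hy, hz, hy0, hz0⟩ := hE α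
      rcases hS y hy with e | e | e <;> rcases hS z hz with e' | e' | e' <;> rw [e] at hy0 <;>
        rw [e'] at hz0 <;> first
        | exact absurd (e.trans e'.symm) hyz
        | tauto
    rcases two_vertices (D := δ) (by omega) (sum a) (sum b) (sum c) h with
      ⟨h1, h2⟩ | ⟨h1, h2⟩ | ⟨h1, h2⟩
    · exact no_two_vertices hδ hsm hu hperp ha hb hc hab hca.symm hcb.symm h1 h2
    · exact no_two_vertices hδ hsm hu hperp ha hc hb hca.symm hab hcb h1 h2
    · exact no_two_vertices hδ hsm hu hperp hb hc ha hcb.symm hab.symm hca h1 h2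
  · push Not at h3
    have h : ∀ α, mm δ a α = 0 := by
      intro α
      obtain ⟨y, z, hyz, hy, hz, hy0, hz0⟩ := hE α
      by_cases e : y = a
      · rw [← e]; exact hy0
      by_cases e' : z = a
      · rw [← e']; exact hz0
      exact absurd ((h3 y hy e).trans (h3 z hz e').symm) hyz
    have := sum a
    rw [h, h, h, h] at this
    omega

/-! ### Tropical lines, their types and interpolation -/

/-- the combinatorial type of the tropical line with vertex `v` and length parameter `t` -/
def LTy (δ : ℕ) (lam : (Fin 3 → ℤ) → ℝ) (i j k l : Fin 4) (v : V3) (t : ℝ) :=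
  (Ty δ lam v (ωdir i) none, Ty δ lam v (ωdir j) none, Ty δ lam v (ωdir k + ωdir l) (some t),
    Ty δ lam (v + t • (ωdir k + ωdir l)) (ωdir k) none,
    Ty δ lam (v + t • (ωdir k + ωdir l)) (ωdir l) none)

lemma mem_seg_iff {v d y : V3} {t : ℝ} (ht : 0 ≤ t) :
    y ∈ segment ℝ v (v + t • d) ↔ ∃ s, 0 ≤ s ∧ s ≤ t ∧ y = v + s • d := by
  rw [segment_eq_image']
  constructor
  · rintro ⟨θ, ⟨h0, h1⟩, rfl⟩
    refine ⟨θ * t, by positivity, by nlinarith, ?_⟩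
    simp only [add_sub_cancel_left, smul_smul]
  · rintro ⟨s, h0, h1, rfl⟩
    rcases ht.eq_or_lt with h | h
    · refine ⟨0, ⟨le_refl _, zero_le_one⟩, ?_⟩
      have : s = 0 := by linarith
      simp [this]
    · refine ⟨s / t, ⟨by positivity, by rw [div_le_one h]; exact h1⟩, ?_⟩
      simp only [add_sub_cancel_left, smul_smul]
      rw [div_mul_cancel₀ _ h.ne']

lemma tline_sub_iff {δ : ℕ} {lam : (Fin 3 → ℤ) → ℝ} {i j k l : Fin 4} {v : V3} {t : ℝ}
    (ht : 0 ≤ t) : TLine v (v + t • (ωdir k + ωdir l)) i j k l ⊆ Vtrop δ lam ↔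
    (∀ s : ℝ, 0 ≤ s → v + s • ωdir i ∈ Vtrop δ lam) ∧
    (∀ s : ℝ, 0 ≤ s → v + s • ωdir j ∈ Vtrop δ lam) ∧
    (∀ s : ℝ, 0 ≤ s → s ≤ t → v + s • (ωdir k + ωdir l) ∈ Vtrop δ lam) ∧
    (∀ s : ℝ, 0 ≤ s → v + t • (ωdir k + ωdir l) + s • ωdir k ∈ Vtrop δ lam) ∧
    (∀ s : ℝ, 0 ≤ s → v + t • (ωdir k + ωdir l) + s • ωdir l ∈ Vtrop δ lam) := by
  constructor
  · intro h
    refine ⟨fun s hs => h ?_, fun s hs => h ?_, fun s hs hst => h ?_, fun s hs => h ?_,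
      fun s hs => h ?_⟩
    · exact Or.inl (Or.inl (Or.inl (Or.inl ⟨s, hs, rfl⟩)))
    · exact Or.inl (Or.inl (Or.inl (Or.inr ⟨s, hs, rfl⟩)))
    · exact Or.inl (Or.inl (Or.inr ((mem_seg_iff ht).mpr ⟨s, hs, hst, rfl⟩)))
    · exact Or.inl (Or.inr ⟨s, hs, rfl⟩)
    · exact Or.inr ⟨s, hs, rfl⟩
  · rintro ⟨h1, h2, h3, h4, h5⟩ y hy
    rcases hy with (((⟨s, hs, rfl⟩ | ⟨s, hs, rfl⟩) | hy) | ⟨s, hs, rfl⟩) | ⟨s, hs, rfl⟩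
    · exact h1 s hs
    · exact h2 s hs
    · obtain ⟨s, hs, hst, rfl⟩ := (mem_seg_iff ht).mp hy
      exact h3 s hs hst
    · exact h4 s hs
    · exact h5 s hs

lemma none_ok (P : ℝ → Prop) : ∀ t : ℝ, (none : Option ℝ) = some t → P t :=
  fun t h => by cases h

lemma interp_ray {δ : ℕ} {lam : (Fin 3 → ℤ) → ℝ} {v0 v1 d : V3}
    (hV : ∀ s : ℝ, 0 ≤ s → v0 + s • d ∈ Vtrop δ lam)
    (hT : Ty δ lam v0 d none = Ty δ lam v1 d none) {θ : ℝ} (h0 : 0 ≤ θ) (h1 : θ ≤ 1) (s : ℝ)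
    (hs : 0 ≤ s) : ((1 - θ) • v0 + θ • v1) + s • d ∈ Vtrop δ lam :=
  interp δ lam v0 v1 d none none (none_ok _) (fun s hs => hV s hs) hT _ _ (by linarith) h0
    (by ring) s hs (fun t0 _ h _ => by cases h)

lemma interp_line {δ : ℕ} {lam : (Fin 3 → ℤ) → ℝ} {i j k l : Fin 4} {v0 v1 : V3} {t0 t1 : ℝ}
    (ht0 : 0 ≤ t0) (ht1 : 0 ≤ t1)
    (hV : TLine v0 (v0 + t0 • (ωdir k + ωdir l)) i j k l ⊆ Vtrop δ lam)
    (hT : LTy δ lam i j k l v0 t0 = LTy δ lam i j k l v1 t1) {θ : ℝ} (h0 : 0 ≤ θ) (h1 : θ ≤ 1) :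
    TLine ((1 - θ) • v0 + θ • v1) (((1 - θ) • v0 + θ • v1) +
      ((1 - θ) * t0 + θ * t1) • (ωdir k + ωdir l)) i j k l ⊆ Vtrop δ lam := by
  have hq : 0 ≤ 1 - θ := by linarith
  have ht : 0 ≤ (1 - θ) * t0 + θ * t1 := by positivity
  obtain ⟨V1, V2, V9, V4, V5⟩ := (tline_sub_iff ht0).mp hV
  simp only [LTy, Prod.mk.injEq] at hT
  obtain ⟨T1, T2, T3, T4, T5⟩ := hT
  have e : ((1 - θ) • v0 + θ • v1) + ((1 - θ) * t0 + θ * t1) • (ωdir k + ωdir l) =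
      (1 - θ) • (v0 + t0 • (ωdir k + ωdir l)) + θ • (v1 + t1 • (ωdir k + ωdir l)) := by module
  rw [tline_sub_iff ht]
  refine ⟨interp_ray V1 T1 h0 h1, interp_ray V2 T2 h0 h1, ?_, ?_, ?_⟩
  · intro s hs hst
    refine interp δ lam v0 v1 _ (some t0) (some t1) ?_ ?_ T3 _ _ hq h0 (by ring) s hs ?_
    · intro t h; cases h; exact ht0
    · intro s hs; exact V9 s hs.1 hs.2
    · intro a b h h'; cases h; cases h'; exact hst
  · rw [e]; exact interp_ray V4 T4 h0 h1
  · rw [e]; exact interp_ray V5 T5 h0 h1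

/-! ### A tropical line determines its vertices -/

lemma tline_symm (v w : V3) (i j k l : Fin 4) : TLine v w i j k l = TLine w v k l i j := by
  ext y
  simp only [TLine, Set.mem_union, segment_symm ℝ v w]
  tauto

lemma perm_swap {i j k l : Fin 4} (hP : ({i, j, k, l} : Finset (Fin 4)) = Finset.univ) :
    ({k, l, i, j} : Finset (Fin 4)) = Finset.univ := by
  revert hP; revert i j k l; decide

lemma w_swap {i j k l : Fin 4} (hP : ({i, j, k, l} : Finset (Fin 4)) = Finset.univ) {v : V3}
    {t : ℝ} : v = (v + t • (ωdir k + ωdir l)) + t • (ωdir i + ωdir j) := by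
  have h := ω_sum hP
  have : (v + t • (ωdir k + ωdir l)) + t • (ωdir i + ωdir j) =
    v + t • (ωdir i + ωdir j + ωdir k + ωdir l) := by module
  rw [this, h]; simp

/-- coordinate functionals, with a fourth one equal to zero -/
def hatf : Fin 4 → (V3 →ₗ[ℝ] ℝ) :=
  ![LinearMap.proj 0, LinearMap.proj 1, LinearMap.proj 2, 0]

lemma exists_functional {i j k l : Fin 4}
    (hP : ({i, j, k, l} : Finset (Fin 4)) = Finset.univ) :
    ∃ f : V3 →ₗ[ℝ] ℝ, f (ωdir i) = 1 ∧ f (ωdir j) = -1 ∧ f (ωdir k) = 0 ∧ f (ωdir l) = 0 := by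
  have hd : i ≠ j ∧ i ≠ k ∧ j ≠ k ∧ i ≠ l ∧ j ≠ l := by revert hP; revert i j k l; decide
  obtain ⟨h1, h2, h3, h4, h5⟩ := hd
  refine ⟨hatf j - hatf i, ?_, ?_, ?_, ?_⟩
  · clear * - h1
    fin_cases i <;> fin_cases j <;> simp [hatf, ωdir] at h1 ⊢
  · clear * - h1
    fin_cases i <;> fin_cases j <;> simp [hatf, ωdir] at h1 ⊢
  · clear * - h1 h2 h3
    fin_cases i <;> fin_cases j <;> fin_cases k <;> simp [hatf, ωdir] at h1 h2 h3 ⊢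
  · clear * - h1 h4 h5
    fin_cases i <;> fin_cases j <;> fin_cases l <;> simp [hatf, ωdir] at h1 h4 h5 ⊢

lemma tline_ray_aux {i j k l : Fin 4} {f : V3 →ₗ[ℝ] ℝ} (fi : f (ωdir i) = 1)
    (fj : f (ωdir j) = -1) (fk : f (ωdir k) = 0) (fl : f (ωdir l) = 0) {v v' : V3} {t t' : ℝ}
    (ht' : 0 ≤ t')
    (h : TLine v (v + t • (ωdir k + ωdir l)) i j k l ⊆
      TLine v' (v' + t' • (ωdir k + ωdir l)) i j k l) : ∃ c : ℝ, v - v' = c • ωdir i := by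
  set s := |f v' - f v| + 1 with hs
  have hs0 : 0 ≤ s := by positivity
  have hlt : f v' < f v + s := by
    have := le_abs_self (f v' - f v)
    linarith
  have hy : v + s • ωdir i ∈ TLine v (v + t • (ωdir k + ωdir l)) i j k l :=
    Or.inl (Or.inl (Or.inl (Or.inl ⟨s, hs0, rfl⟩)))
  have hfy : f (v + s • ωdir i) = f v + s := by simp [fi]
  rcases h hy with (((⟨r, hr, e⟩ | ⟨r, hr, e⟩) | hy) | ⟨r, hr, e⟩) | ⟨r, hr, e⟩
  · refine ⟨r - s, ?_⟩
    rw [sub_smul, sub_eq_sub_iff_add_eq_add, e, add_comm]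
  · exfalso
    rw [e] at hfy
    simp only [map_add, map_smul, fj, smul_eq_mul] at hfy
    linarith
  · exfalso
    obtain ⟨r, hr, _, e⟩ := (mem_seg_iff ht').mp hy
    rw [e] at hfy
    simp only [map_add, map_smul, fk, fl, smul_eq_mul] at hfy
    linarith
  · exfalso
    rw [e] at hfy
    simp only [map_add, map_smul, fk, fl, smul_eq_mul] at hfy
    linarith
  · exfalso
    rw [e] at hfy
    simp only [map_add, map_smul, fk, fl, smul_eq_mul] at hfy
    linarith

lemma tline_swap_ij (v w : V3) (i j k l : Fin 4) : TLine v w i j k l = TLine v w j i k l := by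
  simp only [TLine, Set.union_comm (ray v (ωdir i))]

lemma tline_inj_left {i j k l : Fin 4} (hP : ({i, j, k, l} : Finset (Fin 4)) = Finset.univ)
    {v v' : V3} {t t' : ℝ} (ht' : 0 ≤ t')
    (h : TLine v (v + t • (ωdir k + ωdir l)) i j k l =
      TLine v' (v' + t' • (ωdir k + ωdir l)) i j k l) : v = v' := by
  obtain ⟨f, fi, fj, fk, fl⟩ := exists_functional hP
  obtain ⟨c, hc⟩ := tline_ray_aux fi fj fk fl ht' h.subset
  have h2 := h
  rw [tline_swap_ij _ _ i j, tline_swap_ij _ _ i j] at h2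
  obtain ⟨c', hc'⟩ := tline_ray_aux (f := -f) (by simp [fj]) (by simp [fi]) (by simp [fk])
    (by simp [fl]) ht' h2.subset
  have e := congrArg f (hc.symm.trans hc')
  simp only [map_smul, fi, fj, smul_eq_mul] at e
  have hcc : c' = -c := by linarith
  rw [hcc] at hc'
  have e2 : c • (ωdir i + ωdir j) = 0 := by
    have := hc.symm.trans hc'
    rw [smul_add, this]; module
  rcases smul_eq_zero.mp e2 with h0 | h0
  · rw [h0, zero_smul] at hc
    exact sub_eq_zero.mp hc
  · exact absurd h0 (ω_add_ne (perm_swap hP))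

lemma tline_inj {i j k l : Fin 4} (hP : ({i, j, k, l} : Finset (Fin 4)) = Finset.univ)
    {v v' : V3} {t t' : ℝ} (ht' : 0 ≤ t')
    (h : TLine v (v + t • (ωdir k + ωdir l)) i j k l =
      TLine v' (v' + t' • (ωdir k + ωdir l)) i j k l) : v = v' ∧ t = t' := by
  have h1 := tline_inj_left hP ht' h
  rw [tline_symm, tline_symm v'] at h
  have e := w_swap hP (v := v) (t := t)
  have e' := w_swap hP (v := v') (t := t')
  have h2 : TLine (v + t • (ωdir k + ωdir l)) ((v + t • (ωdir k + ωdir l)) +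
      t • (ωdir i + ωdir j)) k l i j = TLine (v' + t' • (ωdir k + ωdir l))
      ((v' + t' • (ωdir k + ωdir l)) + t' • (ωdir i + ωdir j)) k l i j := by
    rw [← e, ← e']; exact h
  have h3 := tline_inj_left (perm_swap hP) ht' h2
  refine ⟨h1, ?_⟩
  rw [h1] at h3
  have h4 := smul_left_injective ℝ (ω_add_ne hP) (add_left_cancel h3)
  exact h4

/-! ### The main argument -/

lemma Ty_zero {δ : ℕ} {lam : (Fin 3 → ℤ) → ℝ} {v0 v1 d : V3}
    (h : Ty δ lam v0 d none = Ty δ lam v1 d none) : Sarg δ lam v0 = Sarg δ lam v1 := by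
  obtain ⟨s1, _, hS, h0, _⟩ := Ty_transfer h (JJ_zero_mem (τ := none) (none_ok _))
  rw [h0.mp rfl] at hS
  simpa using hS

lemma ray_pair {δ : ℕ} {lam : (Fin 3 → ℤ) → ℝ} (hsm : TropSmooth δ lam) {v0 v1 : V3} {i : Fin 4}
    (hpar : ∀ c : ℝ, v1 - v0 ≠ c • ωdir i)
    (hV : ∀ s : ℝ, 0 ≤ s → v0 + s • ωdir i ∈ Vtrop δ lam)
    (hT : Ty δ lam v0 (ωdir i) none = Ty δ lam v1 (ωdir i) none) :
    ∃ a b : Fin 3 → ℤ, a ≠ b ∧ a ∈ Sarg δ lam v0 ∧ b ∈ Sarg δ lam v0 ∧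
      mm δ a i = 0 ∧ mm δ b i = 0 := by
  obtain ⟨a, b, hab, _, h⟩ := const_edge hsm (ω_ne i) hpar (none_ok _) (fun s hs => hV s hs) hT
  have h0 := h 0 (JJ_zero_mem (none_ok _))
  rw [zero_smul, add_zero] at h0
  exact ⟨a, b, hab, h0.1, h0.2, ray_facet fun s hs => (h s hs).1, ray_facet fun s hs => (h s hs).2⟩

lemma moving_false {δ : ℕ} (hδ : 3 ≤ δ) {lam : (Fin 3 → ℤ) → ℝ} (hsm : TropSmooth δ lam)
    {i j k l : Fin 4} (hP : ({i, j, k, l} : Finset (Fin 4)) = Finset.univ)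
    {v0 v1 : V3} {t0 t1 : ℝ} (ht0 : 0 ≤ t0)
    (hV : TLine v0 (v0 + t0 • (ωdir k + ωdir l)) i j k l ⊆ Vtrop δ lam)
    (hT : LTy δ lam i j k l v0 t0 = LTy δ lam i j k l v1 t1)
    (hui : ∀ c : ℝ, v1 - v0 ≠ c • ωdir i) (huj : ∀ c : ℝ, v1 - v0 ≠ c • ωdir j)
    (huk : ∀ c : ℝ, (v1 + t1 • (ωdir k + ωdir l)) - (v0 + t0 • (ωdir k + ωdir l)) ≠ c • ωdir k)
    (hul : ∀ c : ℝ, (v1 + t1 • (ωdir k + ωdir l)) - (v0 + t0 • (ωdir k + ωdir l)) ≠ c • ωdir l)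
    (hud : 0 < t0 → ∀ c : ℝ, v1 - v0 ≠ c • (ωdir k + ωdir l)) : False := by
  obtain ⟨V1, V2, V9, V4, V5⟩ := (tline_sub_iff ht0).mp hV
  simp only [LTy, Prod.mk.injEq] at hT
  obtain ⟨T1, T2, T3, T4, T5⟩ := hT
  have hpv := sarg_perp (Ty_zero T1)
  have hpw := sarg_perp (Ty_zero T4)
  obtain ⟨p, p', hpp, hp, hp', hp0, hp0'⟩ := ray_pair hsm hui V1 T1
  obtain ⟨q, q', hqq, hq, hq', hq0, hq0'⟩ := ray_pair hsm huj V2 T2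
  obtain ⟨r, r', hrr, hr, hr', hr0, hr0'⟩ := ray_pair hsm huk V4 T4
  obtain ⟨z, z', hzz, hz, hz', hz0, hz0'⟩ := ray_pair hsm hul V5 T5
  rcases ht0.eq_or_lt with h | h
  · rw [← h, zero_smul, add_zero] at hr hr' hz hz'
    refine vertex_zero hδ hsm (u := v1 - v0) (fun h => hui 0 (by simp [h])) hpv ?_
    intro α
    have hα : α = i ∨ α = j ∨ α = k ∨ α = l := by
      have : α ∈ ({i, j, k, l} : Finset (Fin 4)) := by rw [hP]; exact Finset.mem_univ _
      simpa using this
    rcases hα with rfl | rfl | rfl | rfl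
    · exact ⟨p, p', hpp, hp, hp', hp0, hp0'⟩
    · exact ⟨q, q', hqq, hq, hq', hq0, hq0'⟩
    · exact ⟨r, r', hrr, hr, hr', hr0, hr0'⟩
    · exact ⟨z, z', hzz, hz, hz', hz0, hz0'⟩
  · obtain ⟨a, b, hab, habd, hE⟩ := const_edge hsm (τ0 := some t0) (ω_add_ne hP) (hud h)
      (fun t e => by cases e; exact h) (fun s hs => V9 s hs.1 hs.2) T3
    have h0 := hE 0 ⟨le_refl _, ht0⟩
    have h1 := hE t0 ⟨ht0, le_refl _⟩
    rw [zero_smul, add_zero] at h0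
    have sa := mm_sum (δ := δ) hP a
    have sb := mm_sum (δ := δ) hP b
    have hs := mm_of_dot (δ := δ) habd
    have l1 := vertex_le hδ hsm hP hui huj (hud h) hpv h0.1 h0.2 hab habd hp hp' hpp hq hq' hqq
      hp0 hp0' hq0 hq0'
    have hud' : ∀ c : ℝ, (v1 + t1 • (ωdir k + ωdir l)) - (v0 + t0 • (ωdir k + ωdir l)) ≠
        c • (ωdir i + ωdir j) := by
      intro c hc
      apply hud h (t0 - t1 - c)
      have e := ω_sum hP
      have e2 : ωdir i + ωdir j = -(ωdir k + ωdir l) := by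
        rw [eq_neg_iff_add_eq_zero, ← e]; abel
      rw [e2] at hc
      have : v1 - v0 = ((v1 + t1 • (ωdir k + ωdir l)) - (v0 + t0 • (ωdir k + ωdir l))) +
        (t0 - t1) • (ωdir k + ωdir l) := by module
      rw [this, hc]; module
    have l2 := vertex_le hδ hsm (perm_swap hP) huk hul hud' hpw h1.1 h1.2 hab
      (mm_dot_add (δ := δ) (by omega)) hr hr' hrr hz hz' hzz hr0 hr0' hz0 hz0'
    omega

lemma family_infinite {δ : ℕ} {lam : (Fin 3 → ℤ) → ℝ}
    {i j k l : Fin 4} (hP : ({i, j, k, l} : Finset (Fin 4)) = Finset.univ)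
    {v0 v1 : V3} {t0 t1 : ℝ} (ht0 : 0 ≤ t0) (ht1 : 0 ≤ t1)
    (hV : TLine v0 (v0 + t0 • (ωdir k + ωdir l)) i j k l ⊆ Vtrop δ lam)
    (hT : LTy δ lam i j k l v0 t0 = LTy δ lam i j k l v1 t1)
    (hne : ¬ (v0 = v1 ∧ t0 = t1)) {P Q : V3} {ε : ℝ} (hε : 0 < ε) (hε1 : ε ≤ 1)
    (hPQ : ∀ θ : ℝ, 0 ≤ θ → θ ≤ ε →
      P ∈ TLine ((1 - θ) • v0 + θ • v1) (((1 - θ) • v0 + θ • v1) +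
        ((1 - θ) * t0 + θ * t1) • (ωdir k + ωdir l)) i j k l ∧
      Q ∈ TLine ((1 - θ) • v0 + θ • v1) (((1 - θ) • v0 + θ • v1) +
        ((1 - θ) * t0 + θ * t1) • (ωdir k + ωdir l)) i j k l) :
    {L' : Set V3 | IsTropicalLine L' ∧ L' ⊆ Vtrop δ lam ∧ P ∈ L' ∧ Q ∈ L'}.Infinite := by
  have hpos : ∀ θ : ℝ, 0 ≤ θ → θ ≤ ε → 0 ≤ (1 - θ) * t0 + θ * t1 := by
    intro θ h0 h1
    have : 0 ≤ 1 - θ := by linarith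
    positivity
  refine Set.infinite_of_injOn_mapsTo (s := Set.Icc 0 ε)
    (f := fun θ : ℝ => TLine ((1 - θ) • v0 + θ • v1) (((1 - θ) • v0 + θ • v1) +
        ((1 - θ) * t0 + θ * t1) • (ωdir k + ωdir l)) i j k l) ?_ ?_ (Set.Icc_infinite hε)
  · intro θ hθ η hη h
    obtain ⟨e1, e2⟩ := tline_inj hP (hpos η hη.1 hη.2) h
    by_contra hcon
    have hs : θ - η ≠ 0 := sub_ne_zero.mpr hcon
    apply hne
    constructor
    · have : (θ - η) • (v0 - v1) = 0 := by
        have : (θ - η) • (v0 - v1) = ((1 - η) • v0 + η • v1) - ((1 - θ) • v0 + θ • v1) := by module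
        rw [this, e1, sub_self]
      exact sub_eq_zero.mp ((smul_eq_zero.mp this).resolve_left hs)
    · have : (θ - η) * (t0 - t1) = 0 := by linear_combination -e2
      exact sub_eq_zero.mp ((mul_eq_zero.mp this).resolve_left hs)
  · intro θ hθ
    exact ⟨⟨_, _, i, j, k, l, ⟨hP, _, hpos θ hθ.1 hθ.2, rfl⟩, rfl⟩,
      interp_line ht0 ht1 hV hT hθ.1 (hθ.2.trans hε1), hPQ θ hθ.1 hθ.2⟩

lemma ray_mem {v0 v1 d : V3} {c : ℝ} (hc : v1 - v0 = c • d) {θ r : ℝ} (h0 : 0 ≤ θ) (h1 : θ ≤ 1)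
    (hr : 0 ≤ r) : v0 + (|c| + r) • d ∈ ray ((1 - θ) • v0 + θ • v1) d := by
  refine ⟨|c| + r - θ * c, ?_, ?_⟩
  · have h2 := le_abs_self c
    have h3 := abs_nonneg c
    nlinarith
  · have : v1 = v0 + c • d := by rw [← hc]; abel
    rw [this]; module

lemma pts_ne {v d : V3} (hd : d ≠ 0) {r s : ℝ} (h : r ≠ s) : v + r • d ≠ v + s • d := by
  intro e
  exact h (smul_left_injective ℝ hd (add_left_cancel e))

lemma exists_family {δ : ℕ} (hδ : 3 ≤ δ) {lam : (Fin 3 → ℤ) → ℝ} (hsm : TropSmooth δ lam)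
    {i j k l : Fin 4} (hP : ({i, j, k, l} : Finset (Fin 4)) = Finset.univ)
    {v0 v1 : V3} {t0 t1 : ℝ} (ht0 : 0 ≤ t0) (ht1 : 0 ≤ t1)
    (hV : TLine v0 (v0 + t0 • (ωdir k + ωdir l)) i j k l ⊆ Vtrop δ lam)
    (hT : LTy δ lam i j k l v0 t0 = LTy δ lam i j k l v1 t1)
    (hne : ¬ (v0 = v1 ∧ t0 = t1)) :
    ∃ P Q : V3, P ∈ TLine v0 (v0 + t0 • (ωdir k + ωdir l)) i j k l ∧
      Q ∈ TLine v0 (v0 + t0 • (ωdir k + ωdir l)) i j k l ∧ P ≠ Q ∧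
      {L' : Set V3 | IsTropicalLine L' ∧ L' ⊆ Vtrop δ lam ∧ P ∈ L' ∧ Q ∈ L'}.Infinite := by
  -- it is enough to find two points on all nearby interpolated lines
  have main : ∀ (P Q : V3) (ε : ℝ), P ≠ Q → 0 < ε → ε ≤ 1 → (∀ θ : ℝ, 0 ≤ θ → θ ≤ ε →
      P ∈ TLine ((1 - θ) • v0 + θ • v1) (((1 - θ) • v0 + θ • v1) +
        ((1 - θ) * t0 + θ * t1) • (ωdir k + ωdir l)) i j k l ∧
      Q ∈ TLine ((1 - θ) • v0 + θ • v1) (((1 - θ) • v0 + θ • v1) +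
        ((1 - θ) * t0 + θ * t1) • (ωdir k + ωdir l)) i j k l) →
      ∃ P Q : V3, P ∈ TLine v0 (v0 + t0 • (ωdir k + ωdir l)) i j k l ∧
      Q ∈ TLine v0 (v0 + t0 • (ωdir k + ωdir l)) i j k l ∧ P ≠ Q ∧
      {L' : Set V3 | IsTropicalLine L' ∧ L' ⊆ Vtrop δ lam ∧ P ∈ L' ∧ Q ∈ L'}.Infinite := by
    intro P Q ε hne' hε hε1 hPQ
    have h0 := hPQ 0 (le_refl _) hε.le
    simp only [sub_zero, one_smul, zero_smul, add_zero, one_mul, zero_mul] at h0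
    exact ⟨P, Q, h0.1, h0.2, hne', family_infinite hP ht0 ht1 hV hT hne hε hε1 hPQ⟩
  have eqw : ∀ θ : ℝ, ((1 - θ) • v0 + θ • v1) + ((1 - θ) * t0 + θ * t1) • (ωdir k + ωdir l) =
      (1 - θ) • (v0 + t0 • (ωdir k + ωdir l)) + θ • (v1 + t1 • (ωdir k + ωdir l)) := by
    intro θ; module
  by_cases hi : ∃ c : ℝ, v1 - v0 = c • ωdir i
  · obtain ⟨c, hc⟩ := hi
    refine main (v0 + (|c| + 0) • ωdir i) (v0 + (|c| + 1) • ωdir i) 1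
      (pts_ne (ω_ne i) (by simp)) one_pos (le_refl _) ?_
    intro θ h0 h1
    exact ⟨Or.inl (Or.inl (Or.inl (Or.inl (ray_mem hc h0 h1 (le_refl _))))),
      Or.inl (Or.inl (Or.inl (Or.inl (ray_mem hc h0 h1 zero_le_one))))⟩
  by_cases hj : ∃ c : ℝ, v1 - v0 = c • ωdir j
  · obtain ⟨c, hc⟩ := hj
    refine main (v0 + (|c| + 0) • ωdir j) (v0 + (|c| + 1) • ωdir j) 1
      (pts_ne (ω_ne j) (by simp)) one_pos (le_refl _) ?_
    intro θ h0 h1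
    exact ⟨Or.inl (Or.inl (Or.inl (Or.inr (ray_mem hc h0 h1 (le_refl _))))),
      Or.inl (Or.inl (Or.inl (Or.inr (ray_mem hc h0 h1 zero_le_one))))⟩
  by_cases hk : ∃ c : ℝ,
      (v1 + t1 • (ωdir k + ωdir l)) - (v0 + t0 • (ωdir k + ωdir l)) = c • ωdir k
  · obtain ⟨c, hc⟩ := hk
    refine main (v0 + t0 • (ωdir k + ωdir l) + (|c| + 0) • ωdir k)
      (v0 + t0 • (ωdir k + ωdir l) + (|c| + 1) • ωdir k) 1
      (pts_ne (ω_ne k) (by simp)) one_pos (le_refl _) ?_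
    intro θ h0 h1
    rw [eqw]
    exact ⟨Or.inl (Or.inr (ray_mem hc h0 h1 (le_refl _))),
      Or.inl (Or.inr (ray_mem hc h0 h1 zero_le_one))⟩
  by_cases hl : ∃ c : ℝ,
      (v1 + t1 • (ωdir k + ωdir l)) - (v0 + t0 • (ωdir k + ωdir l)) = c • ωdir l
  · obtain ⟨c, hc⟩ := hl
    refine main (v0 + t0 • (ωdir k + ωdir l) + (|c| + 0) • ωdir l)
      (v0 + t0 • (ωdir k + ωdir l) + (|c| + 1) • ωdir l) 1
      (pts_ne (ω_ne l) (by simp)) one_pos (le_refl _) ?_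
    intro θ h0 h1
    rw [eqw]
    exact ⟨Or.inr (ray_mem hc h0 h1 (le_refl _)), Or.inr (ray_mem hc h0 h1 zero_le_one)⟩
  by_cases hd : 0 < t0 ∧ ∃ c : ℝ, v1 - v0 = c • (ωdir k + ωdir l)
  · obtain ⟨hpos, c, hc⟩ := hd
    have hv1 : v1 = v0 + c • (ωdir k + ωdir l) := by rw [← hc]; abel
    have hca := abs_nonneg c
    have hle := le_abs_self c
    have hle' := neg_abs_le c
    have hD : 0 < 3 * (|c| + t0) := by positivity
    refine main (v0 + (t0 / 3) • (ωdir k + ωdir l)) (v0 + (2 * t0 / 3) • (ωdir k + ωdir l))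
      (t0 / (3 * (|c| + t0))) (pts_ne (ω_add_ne hP) (by intro h; linarith)) (by positivity)
      (by rw [div_le_one hD]; linarith) ?_
    intro θ h0 h1
    rw [le_div_iff₀ hD] at h1
    have hθc : θ * c ≤ θ * |c| := mul_le_mul_of_nonneg_left hle h0
    have hθc' : θ * (-|c|) ≤ θ * c := mul_le_mul_of_nonneg_left hle' h0
    have hθt : 0 ≤ θ * t0 := by positivity
    have hθt1 : 0 ≤ θ * t1 := by positivity
    have ht : 0 ≤ (1 - θ) * t0 + θ * t1 := by nlinarith
    refine ⟨Or.inl (Or.inl (Or.inr ((mem_seg_iff ht).mpr ⟨t0 / 3 - θ * c, ?_, ?_, ?_⟩))),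
      Or.inl (Or.inl (Or.inr ((mem_seg_iff ht).mpr ⟨2 * t0 / 3 - θ * c, ?_, ?_, ?_⟩)))⟩
    · nlinarith
    · nlinarith
    · rw [hv1]; module
    · nlinarith
    · nlinarith
    · rw [hv1]; module
  · exfalso
    refine moving_false hδ hsm hP ht0 hV hT (fun c h => hi ⟨c, h⟩) (fun c h => hj ⟨c, h⟩)
      (fun c h => hk ⟨c, h⟩) (fun c h => hl ⟨c, h⟩) (fun hp c h => hd ⟨hp, c, h⟩)


/-- A smooth tropical surface of degree `δ ≥ 3` contains only finitely many isolated
tropical lines, where `L ⊆ V(λ)` is isolated if every pair of distinct points of `L` lies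
on only finitely many tropical lines contained in `V(λ)`. -/
theorem finitely_many_isolated_lines (δ : ℕ) (hδ : 3 ≤ δ)
    (lam : (Fin 3 → ℤ) → ℝ) (hsm : TropSmooth δ lam) :
    {L : Set V3 | IsTropicalLine L ∧ L ⊆ Vtrop δ lam ∧
      ∀ P Q : V3, P ∈ L → Q ∈ L → P ≠ Q →
        {L' : Set V3 | IsTropicalLine L' ∧ L' ⊆ Vtrop δ lam ∧
          P ∈ L' ∧ Q ∈ L'}.Finite}.Finite := by
  by_contra hinf
  have hch : ∀ L : Set V3, ∃ (v : V3) (t : ℝ) (i j k l : Fin 4), IsTropicalLine L →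
      ({i, j, k, l} : Finset (Fin 4)) = Finset.univ ∧ 0 ≤ t ∧
      L = TLine v (v + t • (ωdir k + ωdir l)) i j k l := by
    intro L
    by_cases h : IsTropicalLine L
    · obtain ⟨v, w, i, j, k, l, ⟨hP, t, ht, rfl⟩, hL⟩ := h
      exact ⟨v, t, i, j, k, l, fun _ => ⟨hP, ht, hL⟩⟩
    · exact ⟨0, 0, 0, 0, 0, 0, fun h' => absurd h' h⟩
  choose v t i j k l hdat using hch
  obtain ⟨L0, hL0, L1, hL1, hne, heq⟩ := Set.Infinite.exists_ne_map_eq_of_mapsTo hinf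
    (f := fun L => ((i L, j L, k L, l L), LTy δ lam (i L) (j L) (k L) (l L) (v L) (t L)))
    (t := Set.univ) (fun _ _ => Set.mem_univ _) (Set.finite_univ)
  obtain ⟨hlin0, hsub0, hiso⟩ := hL0
  obtain ⟨hP0, ht0, e0⟩ := hdat L0 hlin0
  obtain ⟨hP1, ht1, e1⟩ := hdat L1 hL1.1
  simp only [Prod.mk.injEq] at heq
  obtain ⟨⟨ei, ej, ek, el⟩, hT⟩ := heq
  rw [← ei, ← ej, ← ek, ← el] at hT e1
  rw [e0] at hsub0
  obtain ⟨P, Q, hP, hQ, hPQ, hI⟩ := exists_family hδ hsm hP0 ht0 ht1 hsub0 hT (by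
    rintro ⟨h1, h2⟩
    apply hne
    rw [e0, e1, h1, h2])
  rw [← e0] at hP hQ
  exact hI (hiso P Q hP hQ hPQ)
end
end

section
/- Let δ ∈ ℕ, λ : A_δ → ℝ, and let a, b ∈ A_δ with a ≠ b. Let C = {x ∈ ℝ³ : λ(a) + ⟨a,x⟩ = λ(b) + ⟨b,x⟩ = f_λ(x)} and assume C is nonempty. Then for each i ∈ {1,2,3,4}: (for every p ∈ C and every t ≥ 0, p + t·ω_i ∈ C) if and only if both a and b lie on the facet F_i of Γ_δ. -/
open scoped BigOperators

noncomputable section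

/-- The simplex `Γ_δ = conv{(0,0,0), (δ,0,0), (0,δ,0), (0,0,δ)} ⊆ ℝ³`. -/
def Gamma (δ : ℝ) : Set V3 :=
  convexHull ℝ {![0, 0, 0], ![δ, 0, 0], ![0, δ, 0], ![0, 0, δ]}

/-- The four facets of `Γ_δ`: `F_i = {x ∈ Γ_δ : x_i = 0}` for `i = 1,2,3`, and
`F₄ = {x ∈ Γ_δ : x₁+x₂+x₃ = δ}`. -/
def Fface (δ : ℝ) : Fin 4 → Set V3 :=
  ![{x | x ∈ Gamma δ ∧ x 0 = 0},
    {x | x ∈ Gamma δ ∧ x 1 = 0},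
    {x | x ∈ Gamma δ ∧ x 2 = 0},
    {x | x ∈ Gamma δ ∧ x 0 + x 1 + x 2 = δ}]

theorem dotZR_ray (c : Fin 3 → ℤ) (p d : V3) (t : ℝ) :
    dotZR c (p + t • d) = dotZR c p + t * dotZR c d := by
  simp [dotZR, Fin.sum_univ_three]; ring

theorem ray_iff_aux (δ : ℕ) (lam : (Fin 3 → ℤ) → ℝ)
    (a b : Fin 3 → ℤ) (ha : a ∈ Adelta δ) (hb : b ∈ Adelta δ)
    (hC : {x : V3 | a ∈ Sarg δ lam x ∧ b ∈ Sarg δ lam x}.Nonempty) (d : V3) (M : ℝ)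
    (hM : ∀ c ∈ Adelta δ, dotZR c d ≤ M) (c₀ : Fin 3 → ℤ) (hc₀ : c₀ ∈ Adelta δ)
    (hc₀M : dotZR c₀ d = M) :
    (∀ p ∈ {x : V3 | a ∈ Sarg δ lam x ∧ b ∈ Sarg δ lam x}, ∀ t : ℝ, 0 ≤ t →
          p + t • d ∈ {x : V3 | a ∈ Sarg δ lam x ∧ b ∈ Sarg δ lam x}) ↔
        (dotZR a d = M ∧ dotZR b d = M) := by
  constructor
  · intro h
    obtain ⟨p, hp⟩ := hC
    have key : ∀ e : Fin 3 → ℤ, e ∈ Adelta δ →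
        (∀ t : ℝ, 0 ≤ t → e ∈ Sarg δ lam (p + t • d)) → dotZR e d = M := by
      intro e he hr
      by_contra hne
      have hlt : 0 < M - dotZR e d := by
        have := lt_of_le_of_ne (hM e he) hne
        linarith
      have h0 := (hr 0 le_rfl).2 c₀ hc₀
      rw [dotZR_ray, dotZR_ray] at h0
      set K := lam e + dotZR e p - (lam c₀ + dotZR c₀ p) with hK
      have hK0 : 0 ≤ K := by rw [hK]; linarith
      have h1 := (hr ((K + 1) / (M - dotZR e d)) (by positivity)).2 c₀ hc₀
      rw [dotZR_ray, dotZR_ray, hc₀M] at h1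
      have h2 : (K + 1) / (M - dotZR e d) * (M - dotZR e d) = K + 1 :=
        div_mul_cancel₀ _ hlt.ne'
      rw [mul_sub] at h2
      linarith
    exact ⟨key a ha fun t ht => (h p hp t ht).1, key b hb fun t ht => (h p hp t ht).2⟩
  · rintro ⟨h1, h2⟩ p hp t ht
    have key : ∀ e : Fin 3 → ℤ, e ∈ Sarg δ lam p → dotZR e d = M →
        e ∈ Sarg δ lam (p + t • d) := by
      intro e he heM
      refine ⟨he.1, fun c hc => ?_⟩
      rw [dotZR_ray, dotZR_ray, heM]
      have := he.2 c hc
      have := mul_le_mul_of_nonneg_left (hM c hc) ht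
      linarith
    exact ⟨key a hp.1 h1, key b hp.2 h2⟩

theorem zToR_mem_Gamma (δ : ℕ) (a : Fin 3 → ℤ) (ha : a ∈ Adelta δ) :
    zToR a ∈ Gamma (δ : ℝ) := by
  obtain ⟨h, hs⟩ := ha
  have h0 := h 0
  have h1 := h 1
  have h2 := h 2
  have hconv : Convex ℝ (Gamma (δ : ℝ)) := convex_convexHull ℝ _
  have m0 : (![0, 0, 0] : V3) ∈ Gamma (δ : ℝ) := subset_convexHull ℝ _ (by simp)
  have m1 : (![(δ : ℝ), 0, 0] : V3) ∈ Gamma (δ : ℝ) := subset_convexHull ℝ _ (by simp)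
  have m2 : (![0, (δ : ℝ), 0] : V3) ∈ Gamma (δ : ℝ) := subset_convexHull ℝ _ (by simp)
  have m3 : (![0, 0, (δ : ℝ)] : V3) ∈ Gamma (δ : ℝ) := subset_convexHull ℝ _ (by simp)
  rcases Nat.eq_zero_or_pos δ with rfl | hδ
  · have e0 : a 0 = 0 := by push_cast at hs; omega
    have e1 : a 1 = 0 := by push_cast at hs; omega
    have e2 : a 2 = 0 := by push_cast at hs; omega
    convert m0 using 1
    ext i
    fin_cases i <;> simp [zToR, e0, e1, e2]
  · have hδ' : (0 : ℝ) < δ := by exact_mod_cast hδ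
    have h0' : (0 : ℝ) ≤ a 0 := by exact_mod_cast h0
    have h1' : (0 : ℝ) ≤ a 1 := by exact_mod_cast h1
    have h2' : (0 : ℝ) ≤ a 2 := by exact_mod_cast h2
    have hs' : (a 0 : ℝ) + a 1 + a 2 ≤ δ := by exact_mod_cast hs
    have := hconv.sum_mem (t := Finset.univ)
      (w := ![1 - (a 0 + a 1 + a 2 : ℝ) / δ, a 0 / δ, a 1 / δ, a 2 / δ])
      (z := ![![0, 0, 0], ![(δ : ℝ), 0, 0], ![0, (δ : ℝ), 0], ![0, 0, (δ : ℝ)]])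
      (by
        have : (a 0 + a 1 + a 2 : ℝ) / δ ≤ 1 := (div_le_one hδ').2 hs'
        intro i _
        fin_cases i <;> simp <;> first | positivity | linarith)
      (by simp [Fin.sum_univ_four]; ring)
      (by
        intro i _
        fin_cases i
        exacts [m0, m1, m2, m3])
    convert this using 1
    ext i
    fin_cases i <;> simp [zToR, Fin.sum_univ_four] <;> field_simp

/-- Let `C` be the (nonempty) closed cell of the tropical surface dual to the edge
joining `a ≠ b` in `A_δ`. For each `i`, the cell `C` contains the whole ray in direction
`ω_i` from each of its points if and only if both `a` and `b` lie on the facet `F_i`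
of `Γ_δ`. -/
theorem cell_unbounded_iff_dual_in_facet (δ : ℕ) (lam : (Fin 3 → ℤ) → ℝ)
    (a b : Fin 3 → ℤ) (ha : a ∈ Adelta δ) (hb : b ∈ Adelta δ) (hab : a ≠ b)
    (hC : {x : V3 | a ∈ Sarg δ lam x ∧ b ∈ Sarg δ lam x}.Nonempty) :
    ∀ i : Fin 4,
      ((∀ p ∈ {x : V3 | a ∈ Sarg δ lam x ∧ b ∈ Sarg δ lam x}, ∀ t : ℝ, 0 ≤ t →
          p + t • ωdir i ∈ {x : V3 | a ∈ Sarg δ lam x ∧ b ∈ Sarg δ lam x}) ↔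
        (zToR a ∈ Fface (δ : ℝ) i ∧ zToR b ∈ Fface (δ : ℝ) i)) := by
  have hGa := zToR_mem_Gamma δ a ha
  have hGb := zToR_mem_Gamma δ b hb
  have z0 : (0 : Fin 3 → ℤ) ∈ Adelta δ := ⟨fun i => le_rfl, by simp⟩
  have z1 : (![(δ : ℤ), 0, 0] : Fin 3 → ℤ) ∈ Adelta δ :=
    ⟨fun i => by fin_cases i <;> simp, by simp⟩
  have hpos : ∀ c ∈ Adelta δ, ∀ i, (0 : ℝ) ≤ c i := fun c hc i => by exact_mod_cast hc.1 i
  intro i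
  fin_cases i
  · refine (ray_iff_aux δ lam a b ha hb hC _ 0 (fun c hc => ?_) 0 z0 ?_).trans ?_
    · simpa [dotZR, ωdir, Fin.sum_univ_three] using hc.1 0
    · simp [dotZR]
    · simp [dotZR, ωdir, Fin.sum_univ_three, Fface, hGa, hGb, zToR]
  · refine (ray_iff_aux δ lam a b ha hb hC _ 0 (fun c hc => ?_) 0 z0 ?_).trans ?_
    · simpa [dotZR, ωdir, Fin.sum_univ_three] using hc.1 1
    · simp [dotZR]
    · simp [dotZR, ωdir, Fin.sum_univ_three, Fface, hGa, hGb, zToR]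
  · refine (ray_iff_aux δ lam a b ha hb hC _ 0 (fun c hc => ?_) 0 z0 ?_).trans ?_
    · simpa [dotZR, ωdir, Fin.sum_univ_three] using hc.1 2
    · simp [dotZR]
    · simp [dotZR, ωdir, Fin.sum_univ_three, Fface, hGa, hGb, zToR]
  · refine (ray_iff_aux δ lam a b ha hb hC _ δ (fun c hc => ?_) _ z1 ?_).trans ?_
    · have h : (c 0 : ℝ) + c 1 + c 2 ≤ δ := by exact_mod_cast hc.2
      simpa [dotZR, ωdir, Fin.sum_univ_three] using h
    · simp [dotZR, ωdir, Fin.sum_univ_three]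
    · simp [dotZR, ωdir, Fin.sum_univ_three, Fface, hGa, hGb, zToR]
end
end

section
/- Define λ on the 20 lattice points of Γ₃ by: λ(3,0,0) = −22, λ(2,1,0) = 16, λ(2,0,1) = −10, λ(1,2,0) = 0, λ(1,0,2) = 0, λ(1,1,1) = 8, λ(0,3,0) = −23, λ(0,2,1) = −12, λ(0,1,2) = −5, λ(0,0,3) = 0, λ(2,0,0) = −14, λ(1,1,0) = 14, λ(1,0,1) = −3, λ(0,2,0) = −6, λ(0,1,1) = 4, λ(0,0,2) = 0, λ(1,0,0) = −8, λ(0,1,0) = 6, λ(0,0,1) = −1, λ(0,0,0) = −3. Then there are infinitely many distinct tropical lines L with L ⊆ V(λ), and each of them contains the point (1, −21, −2). -/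
open scoped BigOperators

noncomputable section

/-- The coefficients of the tropical cubic polynomial `g₃` on the 20 lattice points of
`Γ₃` (and `0` elsewhere; values outside `A₃` are irrelevant to `S_λ` and `V(λ)`). -/
def g3 : (Fin 3 → ℤ) → ℝ := fun a =>
  if a = ![3, 0, 0] then -22 else
  if a = ![2, 1, 0] then 16 else
  if a = ![2, 0, 1] then -10 else
  if a = ![1, 2, 0] then 0 else
  if a = ![1, 0, 2] then 0 else
  if a = ![1, 1, 1] then 8 else
  if a = ![0, 3, 0] then -23 else
  if a = ![0, 2, 1] then -12 else
  if a = ![0, 1, 2] then -5 else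
  if a = ![0, 0, 3] then 0 else
  if a = ![2, 0, 0] then -14 else
  if a = ![1, 1, 0] then 14 else
  if a = ![1, 0, 1] then -3 else
  if a = ![0, 2, 0] then -6 else
  if a = ![0, 1, 1] then 4 else
  if a = ![0, 0, 2] then 0 else
  if a = ![1, 0, 0] then -8 else
  if a = ![0, 1, 0] then 6 else
  if a = ![0, 0, 1] then -1 else
  if a = ![0, 0, 0] then -3 else 0

/-- The values of `g₃` on the 20 lattice points of `Γ₃`, collected into one criterion. -/
lemma g3_le (x y z M : ℝ)
    (h : -22 + 3 * x ≤ M ∧ 16 + 2 * x + y ≤ M ∧ -10 + 2 * x + z ≤ M ∧ x + 2 * y ≤ M ∧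
      x + 2 * z ≤ M ∧ 8 + x + y + z ≤ M ∧ -23 + 3 * y ≤ M ∧ -12 + 2 * y + z ≤ M ∧
      -5 + y + 2 * z ≤ M ∧ 3 * z ≤ M ∧ -14 + 2 * x ≤ M ∧ 14 + x + y ≤ M ∧ -3 + x + z ≤ M ∧
      -6 + 2 * y ≤ M ∧ 4 + y + z ≤ M ∧ 2 * z ≤ M ∧ -8 + x ≤ M ∧ 6 + y ≤ M ∧ -1 + z ≤ M ∧
      -3 ≤ M) :
    ∀ b ∈ Adelta 3, g3 b + dotZR b ![x, y, z] ≤ M := by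
  rintro b ⟨hb, hs⟩
  have h0 := hb 0
  have h1 := hb 1
  have h2 := hb 2
  obtain ⟨p, q, r, rfl⟩ : ∃ p q r : ℤ, b = ![p, q, r] :=
    ⟨b 0, b 1, b 2, by ext i; fin_cases i <;> rfl⟩
  simp only [Matrix.cons_val_zero, Matrix.cons_val_one, Matrix.cons_val, Nat.cast_ofNat] at h0 h1 h2 hs
  have hp : p ≤ 3 := by omega
  have hq : q ≤ 3 := by omega
  have hr : r ≤ 3 := by omega
  clear hb
  interval_cases p <;> interval_cases q <;> interval_cases r <;> first
    | omega
    | (simp [g3, dotZR, Fin.sum_univ_three]; linarith)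

lemma mem_V (x y z : ℝ) (a b : Fin 3 → ℤ) (ha : a ∈ Adelta 3) (hb : b ∈ Adelta 3) (hab : a ≠ b)
    (e : g3 a + dotZR a ![x, y, z] = g3 b + dotZR b ![x, y, z])
    (h : ∀ c ∈ Adelta 3, g3 c + dotZR c ![x, y, z] ≤ g3 a + dotZR a ![x, y, z]) :
    ![x, y, z] ∈ Vtrop 3 g3 :=
  ⟨a, ⟨ha, h⟩, b, ⟨hb, fun c hc => e ▸ h c hc⟩, hab⟩

/-- The horizontal cell `x ≤ 1, y ≤ -21, z = -2`. -/
lemma mem_plane (x y : ℝ) (hx : x ≤ 1) (hy : y ≤ -21) : ![x, y, -2] ∈ Vtrop 3 g3 := by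
  refine mem_V x y (-2) ![0, 0, 1] ![0, 0, 0] ?_ ?_ (by decide) ?_ (g3_le _ _ _ _ ?_)
  · simp [Adelta, Fin.forall_fin_succ]
  · simp [Adelta, Fin.forall_fin_succ]
  · simp [g3, dotZR, Fin.sum_univ_three]; norm_num
  · simp [g3, dotZR, Fin.sum_univ_three]
    refine ⟨?_, ?_, ?_, ?_, ?_, ?_, ?_, ?_, ?_, ?_, ?_, ?_, ?_, ?_, ?_, ?_, ?_, ?_, ?_⟩ <;> linarith

lemma mem_down (t : ℝ) (ht : 0 ≤ t) : ![1, -21, -2 - t] ∈ Vtrop 3 g3 := by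
  refine mem_V 1 (-21) (-2 - t) ![2, 1, 0] ![0, 0, 0] ?_ ?_ (by decide) ?_ (g3_le _ _ _ _ ?_)
  · simp [Adelta, Fin.forall_fin_succ]
  · simp [Adelta, Fin.forall_fin_succ]
  · simp [g3, dotZR, Fin.sum_univ_three]; norm_num
  · simp [g3, dotZR, Fin.sum_univ_three]
    refine ⟨?_, ?_, ?_, ?_, ?_, ?_, ?_, ?_, ?_, ?_, ?_, ?_, ?_, ?_, ?_, ?_, ?_, ?_, ?_, ?_⟩ <;> linarith

lemma mem_up (t : ℝ) (ht : 0 ≤ t) : ![1 + t, -21 + t, -2 + t] ∈ Vtrop 3 g3 := by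
  refine mem_V (1 + t) (-21 + t) (-2 + t) ![2, 1, 0] ![1, 0, 2] ?_ ?_ (by decide) ?_
    (g3_le _ _ _ _ ?_)
  · simp [Adelta, Fin.forall_fin_succ]
  · simp [Adelta, Fin.forall_fin_succ]
  · simp [g3, dotZR, Fin.sum_univ_three]; ring
  · simp [g3, dotZR, Fin.sum_univ_three]
    refine ⟨?_, ?_, ?_, ?_, ?_, ?_, ?_, ?_, ?_, ?_, ?_, ?_, ?_, ?_, ?_, ?_, ?_, ?_, ?_, ?_⟩ <;> linarith

/-- The family of lines. -/
def lineN (n : ℕ) : Set V3 := TLine ![1, -21, -2] ![1 - n, -21 - n, -2] 2 3 0 1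

lemma vec3_eq {u : V3} {x y z : ℝ} (hx : u 0 = x) (hy : u 1 = y) (hz : u 2 = z) :
    u = ![x, y, z] := by
  ext i; fin_cases i <;> simp [hx, hy, hz]

lemma mem_of_eq {u w : V3} (h : u = w) (hw : w ∈ Vtrop 3 g3) : u ∈ Vtrop 3 g3 := h ▸ hw

lemma lineN_sub (n : ℕ) : lineN n ⊆ Vtrop 3 g3 := by
  have hn : (0 : ℝ) ≤ n := n.cast_nonneg
  rintro u ((((⟨t, ht, rfl⟩ | ⟨t, ht, rfl⟩) | ⟨a, b, ha, hb, hab, rfl⟩) | ⟨t, ht, rfl⟩) |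
    ⟨t, ht, rfl⟩)
  · refine mem_of_eq (vec3_eq (x := 1) (y := -21) (z := -2 - t) ?_ ?_ ?_) ?_
    rotate_right
    · exact mem_down t ht
    all_goals simp [ωdir]; try ring
  · refine mem_of_eq (vec3_eq (x := 1 + t) (y := -21 + t) (z := -2 + t) ?_ ?_ ?_) ?_
    rotate_right
    · exact mem_up t ht
    all_goals simp [ωdir]
  · have hbn : 0 ≤ b * n := mul_nonneg hb hn
    obtain rfl : a = 1 - b := by linarith
    refine mem_of_eq (vec3_eq (x := 1 - b * n) (y := -21 - b * n) (z := -2) ?_ ?_ ?_) ?_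
    rotate_right
    · exact mem_plane _ _ (by linarith) (by linarith)
    all_goals simp; ring
  · refine mem_of_eq (vec3_eq (x := 1 - n - t) (y := -21 - n) (z := -2) ?_ ?_ ?_) ?_
    rotate_right
    · exact mem_plane _ _ (by linarith) (by linarith)
    all_goals simp [ωdir]; try ring
  · refine mem_of_eq (vec3_eq (x := 1 - n) (y := -21 - n - t) (z := -2) ?_ ?_ ?_) ?_
    rotate_right
    · exact mem_plane _ _ (by linarith) (by linarith)
    all_goals simp [ωdir]; try ring

lemma lineN_isLine (n : ℕ) : IsTropicalLine (lineN n) := by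
  refine ⟨_, _, 2, 3, 0, 1, ⟨by decide, n, n.cast_nonneg, ?_⟩, rfl⟩
  symm
  apply vec3_eq <;> simp [ωdir] <;> ring

lemma lineN_inj : Function.Injective lineN := by
  intro n m h
  have hn : (0 : ℝ) ≤ n := n.cast_nonneg
  have hm : (0 : ℝ) ≤ m := m.cast_nonneg
  have hmem : (![1 - n - 1, -21 - n, -2] : V3) ∈ lineN n := by
    refine Or.inl (Or.inr ⟨1, zero_le_one, ?_⟩)
    symm
    apply vec3_eq <;> simp [ωdir] <;> ring
  rw [h] at hmem
  obtain ((((⟨t, ht, e⟩ | ⟨t, ht, e⟩) | ⟨a, b, ha, hb, hab, e⟩) | ⟨t, ht, e⟩) |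
    ⟨t, ht, e⟩) := hmem <;>
  · have e0 := congrFun e 0
    have e1 := congrFun e 1
    have e2 := congrFun e 2
    simp [ωdir] at e0 e1 e2
    first
      | exact e1
      | (exfalso; linarith)
      | (have : (n : ℝ) = m := by linarith
         exact_mod_cast this)

/-- The smooth tropical cubic surface `V(g₃)` contains infinitely many tropical lines,
each of which passes through the point `(1, −21, −2)`. -/
theorem cubic_surface_infinitely_many_lines :
    {L : Set V3 | IsTropicalLine L ∧ L ⊆ Vtrop 3 g3 ∧
      (![1, -21, -2] : V3) ∈ L}.Infinite := by
  refine (Set.infinite_range_of_injective lineN_inj).mono ?_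
  rintro _ ⟨n, rfl⟩
  exact ⟨lineN_isLine n, lineN_sub n,
    Or.inl (Or.inl (Or.inr (left_mem_segment ℝ _ _)))⟩
end
end
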